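/- Let ε > 0 and let (A_i)_{i∈ℤ/nℤ} be an ε-flexible contracting linear cocycle in GL(2,ℝ). Then there exists a retardable contracting diffeomorphism cocycle (f_i)_{i∈ℤ/nℤ} on ℝ², with data ((B_i), λ, r, R) where R < 1, such that: (a) f_i(x) = A_i x for every x with ‖x‖ ≥ 1 and every i; (b) for every m ∈ ℕ and all admissible gluing radii, the m-retard (f_{i,m}) satisfies sup_{i,x} ‖Df_{i,m}(x) − A_i‖ < ε; (c) there is a continuous one-parameter family, s ∈ [0,1], of contracting diffeomorphism cocycles joining the linear cocycle (A_i) at s = 0 to (f_i) at s = 1, each member coinciding with (A_i) outside the unit ball, and such that at every parameter s the derivative at the origin of the return map has two distinct real positive eigenvalues; (d) the derivative at the origin of the return map f_{n−1}∘···∘f_0 has one eigenvalue in (0,1) and one eigenvalue equal to 1. -/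

import Mathlib

open Filter Topology

noncomputable section

abbrev M2 := Matrix (Fin 2) (Fin 2) ℝ
abbrev E2 := EuclideanSpace ℝ (Fin 2)

/-- The continuous linear map on Euclidean `ℝ²` induced by a `2 × 2` matrix. -/
def mCLM (A : M2) : E2 →L[ℝ] E2 := Matrix.toEuclideanCLM (𝕜 := ℝ) A

/-- Operator norm (w.r.t. the Euclidean norm) of a `2 × 2` matrix. -/
def mnorm (A : M2) : ℝ := ‖mCLM A‖

/-- Action of a `2 × 2` matrix on a vector of Euclidean `ℝ²`. -/
def mact (A : M2) (x : E2) : E2 := mCLM A x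

/-- The product `A (n-1) * ⋯ * A 0` of a cocycle over `ℤ/nℤ`. -/
def cocProd (n : ℕ) (A : ZMod n → M2) : M2 :=
  (((List.range n).map fun i => A (i : ZMod n)).reverse).prod

/-- The partial product `A (i+j-1) * ⋯ * A i` (indices mod `n`). -/
def partProd (n : ℕ) (A : ZMod n → M2) (i : ZMod n) (j : ℕ) : M2 :=
  (((List.range j).map fun l => A (i + (l : ZMod n))).reverse).prod

/-- The map induced on `ℝ² × ℤ/nℤ` by a cocycle of maps. -/
def step (n : ℕ) (f : ZMod n → E2 → E2) (p : E2 × ZMod n) : E2 × ZMod n :=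
  (f p.2 p.1, p.2 + 1)

/-- A cocycle of maps is contracting if every orbit of the induced map converges to the
zero section. -/
def IsContractingCocycle (n : ℕ) (f : ZMod n → E2 → E2) : Prop :=
  ∀ p : E2 × ZMod n, Tendsto (fun m => ((step n f)^[m] p).1) atTop (𝓝 (0 : E2))

/-- `f` is a `C¹` diffeomorphism of `ℝ²`. -/
def IsC1Diffeo (f : E2 → E2) : Prop :=
  ContDiff ℝ 1 f ∧ Function.Bijective f ∧ ContDiff ℝ 1 (Function.invFun f)

/-- A diffeomorphism cocycle over `ℤ/nℤ`: a family of `C¹` diffeomorphisms of `ℝ²`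
fixing the origin. -/
def IsDiffeoCocycle (n : ℕ) (f : ZMod n → E2 → E2) : Prop :=
  ∀ i, IsC1Diffeo (f i) ∧ f i 0 = 0

/-- `f (i+j-1) ∘ ⋯ ∘ f i`, the composition of `j` consecutive maps of the cocycle. -/
def compUpTo (n : ℕ) (f : ZMod n → E2 → E2) (i : ZMod n) : ℕ → E2 → E2
  | 0 => id
  | j + 1 => f (i + (j : ZMod n)) ∘ compUpTo n f i j

end

/-- An `ε`-flexible linear cocycle over `ℤ/nℤ` (Definition 1.1 of the paper). -/
def IsFlexible (n : ℕ) (ε : ℝ) (A : ZMod n → M2) : Prop :=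
  ∃ Af : ℝ → ZMod n → M2,
    -- a continuous one-parameter family of linear cocycles over `t ∈ [-1, 1]`
    (∀ i, ContinuousOn (fun t => Af t i) (Set.Icc (-1 : ℝ) 1)) ∧
    (∀ t ∈ Set.Icc (-1 : ℝ) 1, ∀ i, IsUnit (Af t i)) ∧
    -- the diameter of the family is `< ε`
    (∀ s ∈ Set.Icc (-1 : ℝ) 1, ∀ t ∈ Set.Icc (-1 : ℝ) 1, ∀ i,
      mnorm (Af s i - Af t i) < ε) ∧
    -- at `t = 0` it is the given cocycle
    Af 0 = A ∧
    -- at `t = -1` the product in the period is a homothety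
    (∃ c : ℝ, cocProd n (Af (-1)) = c • (1 : M2)) ∧
    -- for `t ∈ (-1,1)` the product has two distinct positive contracting eigenvalues
    (∀ t ∈ Set.Ioo (-1 : ℝ) 1, ∃ μ₁ μ₂ : ℝ, 0 < μ₂ ∧ μ₂ < μ₁ ∧ μ₁ < 1 ∧
      (cocProd n (Af t)).charpoly
        = (Polynomial.X - Polynomial.C μ₁) * (Polynomial.X - Polynomial.C μ₂)) ∧
    -- the smallest eigenvalue of the product is `< 1` for every `t ∈ [-1,1]`
    (∀ t ∈ Set.Icc (-1 : ℝ) 1, ∃ μ : ℝ, μ < 1 ∧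
      (cocProd n (Af t)).charpoly.IsRoot μ ∧
      ∀ μ' : ℝ, (cocProd n (Af t)).charpoly.IsRoot μ' → μ ≤ μ') ∧
    -- at `t = 1` the product has a real positive eigenvalue equal to `1`
    (cocProd n (Af 1)).charpoly.IsRoot 1

/-- A diffeomorphism cocycle is retardable with data `(B, lam, r, R)` if it is linear, given by
`B i`, on the annulus `r ≤ ‖x‖ ≤ R`, and the product of the `B i` in the period is the homothety
of ratio `lam ∈ (0,1)`, with `0 < r < lam * R`. -/
def IsRetardable (n : ℕ) (f : ZMod n → E2 → E2) (B : ZMod n → M2) (lam r R : ℝ) : Prop :=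
  (∀ i, IsUnit (B i)) ∧ 0 < lam ∧ lam < 1 ∧ 0 < r ∧ r < lam * R ∧
  cocProd n B = lam • (1 : M2) ∧
  ∀ (i : ZMod n) (x : E2), r ≤ ‖x‖ → ‖x‖ ≤ R → f i x = mact (B i) x

/-- The `m`-retard of a retardable cocycle, for gluing radii `r < ρ' < ρ < R`. -/
noncomputable def retard (n : ℕ) (f : ZMod n → E2 → E2) (B : ZMod n → M2) (lam ρ' ρ : ℝ) (m : ℕ) :
    ZMod n → E2 → E2 := fun i x =>
  if ρ ≤ ‖x‖ then f i x
  else if lam ^ m * ρ' ≤ ‖x‖ then mact (B i) x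
  else lam ^ m • f i ((lam ^ m)⁻¹ • x)

/-- `f` is an `ε`-perturbation of the linear cocycle `A`: each `f i` coincides with `A i`
outside a bounded set, and `sup_{i,x} ‖D(f i)(x) - A i‖ < ε`. -/
def IsPerturbation (n : ℕ) (ε : ℝ) (f : ZMod n → E2 → E2) (A : ZMod n → M2) : Prop :=
  (∀ i, Bornology.IsBounded {x : E2 | f i x ≠ mact (A i) x}) ∧
  ∃ c : ℝ, c < ε ∧ ∀ (i : ZMod n) (x : E2), ‖fderiv ℝ (f i) x - mCLM (A i)‖ ≤ c

section RadialMaps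

variable {E : Type*} [NormedAddCommGroup E] [InnerProductSpace ℝ E]

/-- The map `x ↦ D (‖x‖²) x` attached to a one-parameter family of linear maps. -/
def radialMap (D : ℝ → E →L[ℝ] E) (x : E) : E := D (‖x‖ ^ 2) x

theorem radialMap_zero (D : ℝ → E →L[ℝ] E) : radialMap D 0 = 0 := by simp [radialMap]

theorem contDiff_radialMap {D : ℝ → E →L[ℝ] E} (hD : ContDiff ℝ 1 D) :
    ContDiff ℝ 1 (radialMap D) :=
  (hD.comp (contDiff_norm_sq ℝ)).clm_apply contDiff_id

theorem hasFDerivAt_radialMap {D : ℝ → E →L[ℝ] E} (hD : ContDiff ℝ 1 D) (x : E) :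
    HasFDerivAt (radialMap D)
      (D (‖x‖ ^ 2) + ((2 : ℝ) • innerSL ℝ x).smulRight (deriv D (‖x‖ ^ 2) x)) x := by
  have h1 : HasFDerivAt (fun y : E => ‖y‖ ^ 2) ((2 : ℝ) • innerSL ℝ x) x := by
    refine (hasStrictFDerivAt_norm_sq x).hasFDerivAt.congr_fderiv ?_
    rw [two_smul, two_smul]
  have h2 : HasFDerivAt (fun y : E => D (‖y‖ ^ 2))
      (((2 : ℝ) • innerSL ℝ x).smulRight (deriv D (‖x‖ ^ 2))) x := by
    refine ((hD.differentiable one_ne_zero _).hasDerivAt.hasFDerivAt.comp x h1).congr_fderiv ?_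
    ext v w
    simp [mul_smul]
  have h3 := h2.clm_apply (hasFDerivAt_id x)
  refine h3.congr_fderiv ?_
  ext v
  simp

theorem norm_fderiv_radialMap_sub_le {D : ℝ → E →L[ℝ] E} (hD : ContDiff ℝ 1 D) {η : ℝ}
    (hη : ∀ σ, 2 * (|σ| * ‖deriv D σ‖) ≤ η) (x : E) :
    ‖fderiv ℝ (radialMap D) x - D (‖x‖ ^ 2)‖ ≤ η := by
  rw [(hasFDerivAt_radialMap hD x).fderiv, add_sub_cancel_left,
    ContinuousLinearMap.norm_smulRight_apply, norm_smul, innerSL_apply_norm]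
  refine le_trans ?_ (hη (‖x‖ ^ 2))
  have := (deriv D (‖x‖ ^ 2)).le_opNorm x
  rw [abs_of_nonneg (sq_nonneg ‖x‖)]
  calc ‖(2 : ℝ)‖ * ‖x‖ * ‖deriv D (‖x‖ ^ 2) x‖
      ≤ ‖(2 : ℝ)‖ * ‖x‖ * (‖deriv D (‖x‖ ^ 2)‖ * ‖x‖) := by gcongr
    _ = 2 * (‖x‖ ^ 2 * ‖deriv D (‖x‖ ^ 2)‖) := by norm_num; ring

theorem fderiv_radialMap_zero {D : ℝ → E →L[ℝ] E} (hD : ContDiff ℝ 1 D) :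
    HasFDerivAt (radialMap D) (D 0) 0 := by
  refine (hasFDerivAt_radialMap hD 0).congr_fderiv ?_
  ext v
  simp

/-- A family with `2 |σ| ‖D'(σ)‖ ≤ η` is Lipschitz in logarithmic scale. -/
theorem norm_sub_le_log_of_rate {F : Type*} [NormedAddCommGroup F] [NormedSpace ℝ F]
    {D : ℝ → F} (hD : ContDiff ℝ 1 D) {η : ℝ}
    (hη : ∀ σ, 2 * (|σ| * ‖deriv D σ‖) ≤ η) {a b : ℝ} (ha : 0 < a) (hb : 0 < b) :
    ‖D b - D a‖ ≤ η / 2 * |Real.log b - Real.log a| := by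
  have hd : ∀ w ∈ (Set.univ : Set ℝ), HasDerivWithinAt (fun w => D (Real.exp w))
      (Real.exp w • deriv D (Real.exp w)) Set.univ w := fun w _ =>
    ((hD.differentiable one_ne_zero _).hasDerivAt.scomp w (Real.hasDerivAt_exp w)).hasDerivWithinAt
  have hb' : ∀ w ∈ (Set.univ : Set ℝ), ‖Real.exp w • deriv D (Real.exp w)‖ ≤ η / 2 := by
    intro w _
    have := hη (Real.exp w)
    rw [norm_smul, Real.norm_eq_abs]
    linarith
  have := convex_univ.norm_image_sub_le_of_norm_hasDerivWithin_le hd hb'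
    (Set.mem_univ (Real.log a)) (Set.mem_univ (Real.log b))
  simpa [Real.exp_log ha, Real.exp_log hb] using this

theorem radialMap_injective {D : ℝ → E →L[ℝ] E} (hD : ContDiff ℝ 1 D) {η k : ℝ}
    (hη : ∀ σ, 2 * (|σ| * ‖deriv D σ‖) ≤ η) (hηk : η < k)
    (hlow : ∀ σ v, k * ‖v‖ ≤ ‖D σ v‖) : Function.Injective (radialMap D) := by
  have hη0 : 0 ≤ η := le_trans (by positivity) (hη 0)
  have hk : 0 < k := hη0.trans_lt hηk
  have h0 : ∀ σ v, D σ v = 0 → v = 0 := by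
    intro σ v hv
    have := hlow σ v
    rw [hv, norm_zero] at this
    exact norm_le_zero_iff.1 (nonpos_of_mul_nonpos_right this hk)
  have key : ∀ x y : E, ‖x‖ < ‖y‖ → radialMap D x ≠ radialMap D y := by
    intro x y hxy he
    by_cases hx : x = 0
    · subst hx
      rw [radialMap_zero] at he
      have := h0 _ _ he.symm
      simp [this] at hxy
    have hx0 : 0 < ‖x‖ := norm_pos_iff.2 hx
    have hy0 : 0 < ‖y‖ := hx0.trans hxy
    have h1 : D (‖y‖ ^ 2) (x - y) = (D (‖y‖ ^ 2) - D (‖x‖ ^ 2)) x := by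
      simp only [radialMap] at he
      simp [he]
    have h2 := hlow (‖y‖ ^ 2) (x - y)
    rw [h1] at h2
    have h3 := (D (‖y‖ ^ 2) - D (‖x‖ ^ 2)).le_opNorm x
    have h4 := norm_sub_le_log_of_rate hD hη (pow_pos hx0 2) (pow_pos hy0 2)
    have h5 : ‖y‖ - ‖x‖ ≤ ‖x - y‖ := by
      rw [norm_sub_rev]; exact norm_sub_norm_le y x
    have h6 : |Real.log (‖y‖ ^ 2) - Real.log (‖x‖ ^ 2)| * ‖x‖ ≤ 2 * (‖y‖ - ‖x‖) := by
      rw [Real.log_pow, Real.log_pow, ← mul_sub, ← Real.log_div hy0.ne' hx0.ne', abs_mul,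
        abs_of_nonneg (Real.log_nonneg ((one_le_div hx0).2 hxy.le))]
      have := Real.log_le_sub_one_of_pos (div_pos hy0 hx0)
      have h7 : Real.log (‖y‖ / ‖x‖) * ‖x‖ ≤ (‖y‖ / ‖x‖ - 1) * ‖x‖ := by gcongr
      rw [sub_mul, div_mul_cancel₀ _ hx0.ne'] at h7
      norm_num
      linarith
    have h8 : ‖D (‖y‖ ^ 2) - D (‖x‖ ^ 2)‖ * ‖x‖ ≤ η * (‖y‖ - ‖x‖) := by
      calc _ ≤ (η / 2 * |Real.log (‖y‖ ^ 2) - Real.log (‖x‖ ^ 2)|) * ‖x‖ := by gcongr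
        _ = η / 2 * (|Real.log (‖y‖ ^ 2) - Real.log (‖x‖ ^ 2)| * ‖x‖) := by ring
        _ ≤ η / 2 * (2 * (‖y‖ - ‖x‖)) := by gcongr
        _ = _ := by ring
    have h9 : k * (‖y‖ - ‖x‖) ≤ k * ‖x - y‖ := by gcongr
    nlinarith
  intro x y he
  rcases lt_trichotomy ‖x‖ ‖y‖ with h | h | h
  · exact absurd he (key x y h)
  · simp only [radialMap, h] at he
    exact sub_eq_zero.1 (h0 (‖y‖ ^ 2) (x - y) (by rw [map_sub, he, sub_self]))
  · exact absurd he.symm (key y x h)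

theorem isUnit_of_lower_bound [FiniteDimensional ℝ E] {T : E →L[ℝ] E} {k : ℝ} (hk : 0 < k)
    (h : ∀ v, k * ‖v‖ ≤ ‖T v‖) : IsUnit T := by
  have hinj : Function.Injective (T : E →ₗ[ℝ] E) := by
    refine (injective_iff_map_eq_zero _).2 fun v hv => ?_
    have := h v
    rw [show T v = 0 from hv, norm_zero] at this
    exact norm_le_zero_iff.1 (nonpos_of_mul_nonpos_right this hk)
  let e := (LinearEquiv.ofInjectiveEndo (T : E →ₗ[ℝ] E) hinj).toContinuousLinearEquiv
  refine ⟨ContinuousLinearEquiv.toUnit e, ?_⟩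
  ext v
  rfl

theorem radialMap_surjective [FiniteDimensional ℝ E] {D : ℝ → E →L[ℝ] E} (hD : Continuous D)
    {k : ℝ} (hk : 0 < k) (hlow : ∀ σ v, k * ‖v‖ ≤ ‖D σ v‖) :
    Function.Surjective (radialMap D) := by
  intro y
  have hu : ∀ σ, IsUnit (D σ) := fun σ => isUnit_of_lower_bound hk (hlow σ)
  have hinv : ∀ σ, D σ (Ring.inverse (D σ) y) = y := by
    intro σ
    have := Ring.mul_inverse_cancel _ (hu σ)
    simpa using congrArg (fun T : E →L[ℝ] E => T y) this
  have hcont : Continuous fun σ => Ring.inverse (D σ) := by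
    rw [continuous_iff_continuousAt]
    intro σ
    obtain ⟨u, hu'⟩ := hu σ
    have := NormedRing.inverse_continuousAt u
    rw [hu'] at this
    exact ContinuousAt.comp (g := Ring.inverse) this hD.continuousAt
  have hb : ∀ σ, ‖Ring.inverse (D σ) y‖ ≤ ‖y‖ / k := by
    intro σ
    rw [le_div_iff₀ hk, mul_comm]
    simpa [hinv] using hlow σ (Ring.inverse (D σ) y)
  have hc : Continuous fun σ => ‖Ring.inverse (D σ) y‖ ^ 2 - σ := by fun_prop
  have h0 : (0 : ℝ) ≤ (‖y‖ / k) ^ 2 := by positivity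
  obtain ⟨σ, -, hσ⟩ := intermediate_value_Icc' h0 hc.continuousOn
    (show (0 : ℝ) ∈ _ from ⟨by simpa using pow_le_pow_left₀ (norm_nonneg _) (hb _) 2, by simp⟩)
  refine ⟨Ring.inverse (D σ) y, ?_⟩
  have : ‖Ring.inverse (D σ) y‖ ^ 2 = σ := by linarith
  rw [radialMap, this, hinv]

theorem contDiff_invFun_of_bijective [FiniteDimensional ℝ E] {f : E → E} (hf : ContDiff ℝ 1 f)
    (hbij : Function.Bijective f)
    (hu : ∀ x, IsUnit (fderiv ℝ f x)) : ContDiff ℝ 1 (Function.invFun f) := by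
  rw [contDiff_iff_contDiffAt]
  intro y
  obtain ⟨x, rfl⟩ := hbij.2 y
  obtain ⟨u, hu'⟩ := hu x
  have hd : HasFDerivAt f ((ContinuousLinearEquiv.unitsEquiv ℝ E u : E ≃L[ℝ] E) : E →L[ℝ] E) x := by
    have := (hf.differentiable one_ne_zero x).hasFDerivAt
    rw [← hu'] at this
    exact this
  have hloc := hf.contDiffAt.to_localInverse (a := x) hd one_ne_zero
  refine hloc.congr_of_eventuallyEq ?_
  have hstrict := hf.contDiffAt.hasStrictFDerivAt' (x := x) hd one_ne_zero
  filter_upwards [hstrict.eventually_right_inverse] with z hz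
  apply hbij.1
  rw [Function.invFun_eq (hbij.2 z)]
  exact hz.symm

theorem contDiff_invFun_radialMap [FiniteDimensional ℝ E] {D : ℝ → E →L[ℝ] E}
    (hD : ContDiff ℝ 1 D) {η k : ℝ}
    (hη : ∀ σ, 2 * (|σ| * ‖deriv D σ‖) ≤ η) (hηk : η < k)
    (hlow : ∀ σ v, k * ‖v‖ ≤ ‖D σ v‖) :
    Function.Bijective (radialMap D) ∧ ContDiff ℝ 1 (Function.invFun (radialMap D)) := by
  have hη0 : 0 ≤ η := le_trans (by positivity) (hη 0)
  have hbij : Function.Bijective (radialMap D) :=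
    ⟨radialMap_injective hD hη hηk hlow,
      radialMap_surjective hD.continuous (hη0.trans_lt hηk) hlow⟩
  refine ⟨hbij, contDiff_invFun_of_bijective (contDiff_radialMap hD) hbij fun x => ?_⟩
  refine isUnit_of_lower_bound (sub_pos.2 hηk) fun v => ?_
  have h1 := (fderiv ℝ (radialMap D) x - D (‖x‖ ^ 2)).le_of_opNorm_le
    (norm_fderiv_radialMap_sub_le hD hη x) v
  have h2 := hlow (‖x‖ ^ 2) v
  have h3 := norm_sub_norm_le (D (‖x‖ ^ 2) v) (fderiv ℝ (radialMap D) x v)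
  rw [norm_sub_rev] at h3
  rw [_root_.sub_apply] at h1
  linarith

end RadialMaps

section SequenceProducts

variable {R : Type*}

/-- The ordered product `X (N-1) * ⋯ * X 0`. -/
def seqProd [Monoid R] (X : ℕ → R) : ℕ → R
  | 0 => 1
  | N + 1 => X N * seqProd X N

theorem seqProd_add [Monoid R] (X : ℕ → R) (a b : ℕ) :
    seqProd X (a + b) = seqProd (fun j => X (a + j)) b * seqProd X a := by
  induction b with
  | zero => simp [seqProd]
  | succ b ih => rw [← add_assoc, seqProd, ih, seqProd, mul_assoc]

theorem map_seqProd {S : Type*} [Monoid R] [Monoid S] (φ : R →* S) (X : ℕ → R) (N : ℕ) :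
    φ (seqProd X N) = seqProd (fun j => φ (X j)) N := by
  induction N with
  | zero => simp [seqProd]
  | succ N ih => simp [seqProd, ih]

theorem list_prod_eq_seqProd [Monoid R] (X : ℕ → R) (N : ℕ) :
    (((List.range N).map X).reverse).prod = seqProd X N := by
  induction N with
  | zero => simp [seqProd]
  | succ N ih => simp [List.range_succ, seqProd, ih]

theorem seqProd_smul [NormedRing R] [NormedAlgebra ℝ R]
    (c : ℝ) (X : ℕ → R) (N : ℕ) : seqProd (fun j => c • X j) N = c ^ N • seqProd X N := by
  induction N with
  | zero => simp [seqProd]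
  | succ N ih => rw [seqProd, ih, seqProd, smul_mul_smul_comm, pow_succ']

/-- The product of `N` consecutive terms of a cocycle over `ℤ/nℤ`, starting from `i`. -/
def cocycleProd {n : ℕ} [Monoid R] (C : ZMod n → R) (i : ZMod n) (N : ℕ) : R :=
  seqProd (fun j => C (i + j)) N

theorem cocycleProd_add {n : ℕ} [Monoid R] (C : ZMod n → R) (i : ZMod n) (a b : ℕ) :
    cocycleProd C i (a + b) = cocycleProd C (i + a) b * cocycleProd C i a := by
  rw [cocycleProd, seqProd_add, cocycleProd, cocycleProd]
  simp only [Nat.cast_add, add_assoc]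

theorem cocycleProd_zero_mul_add {n : ℕ} [Monoid R] (C : ZMod n → R) (q r : ℕ) :
    cocycleProd C 0 (n * q + r) = cocycleProd C 0 r * cocycleProd C 0 n ^ q := by
  have h : cocycleProd C 0 (n * q) = cocycleProd C 0 n ^ q := by
    induction q with
    | zero => simp [cocycleProd, seqProd]
    | succ q ih => rw [Nat.mul_succ, cocycleProd_add, ih, pow_succ']; simp
  rw [cocycleProd_add, h]
  simp

theorem cocycleProd_eq {n : ℕ} [NeZero n] [Monoid R] (C : ZMod n → R) (i : ZMod n) {N : ℕ}
    (hN : n ≤ N) :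
    cocycleProd C i N = cocycleProd C 0 ((N - (n - i.val)) % n) *
      cocycleProd C 0 n ^ ((N - (n - i.val)) / n) * cocycleProd C i (n - i.val) := by
  have hi : i + ((n - i.val : ℕ) : ZMod n) = 0 := by
    rw [Nat.cast_sub i.val_lt.le, ZMod.natCast_zmod_val]
    simp
  have h := cocycleProd_add C i (n - i.val) (N - (n - i.val))
  rw [Nat.add_sub_cancel' (by omega), hi] at h
  rw [h, ← cocycleProd_zero_mul_add, Nat.div_add_mod]

theorem exists_bound_cocycleProd_le {n : ℕ} [NeZero n] [NormedRing R] (C : ZMod n → R) (m : ℕ) :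
    ∃ W : ℝ, 1 ≤ W ∧ ∀ i, ∀ j ≤ m, ‖cocycleProd C i j‖ ≤ W := by
  obtain ⟨W, hW⟩ := (((Set.finite_univ (α := ZMod n)).prod (Set.finite_Iic m)).image
    fun p => ‖cocycleProd C p.1 p.2‖).bddAbove
  refine ⟨max W 1, le_max_right _ _, fun i j hj => le_max_of_le_left ?_⟩
  exact hW ⟨(i, j), ⟨trivial, hj⟩, rfl⟩

theorem norm_cocycleProd_le {n : ℕ} [NeZero n] [NormedRing R] (C : ZMod n → R) :
    ∃ W : ℝ, 1 ≤ W ∧ (∀ i, ∀ N < n, ‖cocycleProd C i N‖ ≤ W) ∧ ∀ i N, n ≤ N →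
      ‖cocycleProd C i N‖ ≤ W * ‖cocycleProd C 0 n ^ ((N - (n - i.val)) / n)‖ * W := by
  obtain ⟨W, hW1, hW⟩ := exists_bound_cocycleProd_le C n
  refine ⟨W, hW1, fun i N hN => hW i N hN.le, fun i N hN => ?_⟩
  rw [cocycleProd_eq C i hN]
  refine (norm_mul_le _ _).trans ?_
  gcongr
  · exact (norm_mul_le _ _).trans (mul_le_mul_of_nonneg_right
      (hW _ _ (Nat.mod_lt _ (NeZero.pos n)).le) (norm_nonneg _))
  · exact hW _ _ (Nat.sub_le _ _)

theorem tendsto_cocycleProd {n : ℕ} [NeZero n] [NormedRing R] (C : ZMod n → R)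
    (h : Tendsto (fun q => cocycleProd C 0 n ^ q) atTop (𝓝 0)) (i : ZMod n) :
    Tendsto (cocycleProd C i) atTop (𝓝 0) := by
  obtain ⟨W, -, -, hW⟩ := norm_cocycleProd_le C
  have hq : Tendsto (fun N => (N - (n - i.val)) / n) atTop atTop :=
    (Nat.tendsto_div_const_atTop (NeZero.ne n)).comp (tendsto_sub_atTop_nat _)
  have h1 := ((h.comp hq).norm.const_mul W).mul_const W
  rw [norm_zero, mul_zero, zero_mul] at h1
  refine squeeze_zero_norm' ?_ h1
  filter_upwards [eventually_ge_atTop n] with N hN using hW i N hN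

theorem exists_bound_cocycleProd {n : ℕ} [NeZero n] [NormedRing R] (C : ZMod n → R) {b : ℝ}
    (h : ∀ q, ‖cocycleProd C 0 n ^ q‖ ≤ b) : ∃ M : ℝ, 1 ≤ M ∧ ∀ i N, ‖cocycleProd C i N‖ ≤ M := by
  obtain ⟨W, hW1, hW2, hW⟩ := norm_cocycleProd_le C
  refine ⟨max W (W * b * W), le_max_of_le_left hW1, fun i N => ?_⟩
  rcases lt_or_ge N n with hN | hN
  · exact le_max_of_le_left (hW2 i N hN)
  · exact le_max_of_le_right ((hW i N hN).trans (by gcongr; exact h _))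

theorem eventually_seqProd_near [NormedRing R] (Y : ℕ → R) (N : ℕ) {e : ℝ} (he : 0 < e) :
    ∀ᶠ δ in 𝓝[>] (0 : ℝ), ∀ X : ℕ → R, (∀ j < N, ‖X j - Y j‖ < δ) →
      ‖seqProd X N - seqProd Y N‖ < e := by
  induction N generalizing e with
  | zero => simp [seqProd, he]
  | succ N ih =>
    have hc : ContinuousAt (fun p : R × R => p.1 * p.2) (Y N, seqProd Y N) :=
      continuous_mul.continuousAt
    obtain ⟨d, hd, h⟩ := Metric.continuousAt_iff.1 hc e he
    filter_upwards [ih hd, Ioo_mem_nhdsGT hd] with δ h1 h2 X hX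
    have h3 := h1 X fun j hj => hX j (by omega)
    have h4 := (hX N (by omega)).trans h2.2
    have := @h (X N, seqProd X N) (by
      rw [Prod.dist_eq, dist_eq_norm, dist_eq_norm]
      exact max_lt h4 h3)
    simpa [dist_eq_norm, seqProd] using this

/-- Over a compact set of uniformly attracting linear cocycles, products along slowly varying
sequences of cocycles are contracted by a factor `1/2` after a bounded time. -/
theorem exists_uniform_contraction {n : ℕ} [NeZero n] [NormedRing R] {Γ : Set (ZMod n → R)}
    (hΓ : IsCompact Γ) (h : ∀ C ∈ Γ, ∀ i, Tendsto (cocycleProd C i) atTop (𝓝 0)) :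
    ∃ (K : ℕ) (δ : ℝ), 0 < δ ∧ ∀ C ∈ Γ, ∃ N, 1 ≤ N ∧ N ≤ K ∧ ∀ (i : ZMod n) (X : ℕ → R),
      (∀ j < N, ‖X j - C (i + j)‖ < δ) → ‖seqProd X N‖ ≤ 1 / 2 := by
  refine hΓ.induction_on (p := fun S => ∃ (K : ℕ) (δ : ℝ), 0 < δ ∧ ∀ C ∈ S, ∃ N, 1 ≤ N ∧ N ≤ K ∧
    ∀ (i : ZMod n) (X : ℕ → R), (∀ j < N, ‖X j - C (i + j)‖ < δ) → ‖seqProd X N‖ ≤ 1 / 2)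
    ?_ ?_ ?_ ?_
  · exact ⟨0, 1, one_pos, by simp⟩
  · rintro s t hst ⟨K, δ, hδ, H⟩
    exact ⟨K, δ, hδ, fun C hC => H C (hst hC)⟩
  · rintro s t ⟨K, δ, hδ, H⟩ ⟨K', δ', hδ', H'⟩
    refine ⟨max K K', min δ δ', lt_min hδ hδ', ?_⟩
    rintro C (hC | hC)
    · obtain ⟨N, h1, h2, h3⟩ := H C hC
      exact ⟨N, h1, le_max_of_le_left h2, fun i X hX =>
        h3 i X fun j hj => (hX j hj).trans_le (min_le_left _ _)⟩
    · obtain ⟨N, h1, h2, h3⟩ := H' C hC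
      exact ⟨N, h1, le_max_of_le_right h2, fun i X hX =>
        h3 i X fun j hj => (hX j hj).trans_le (min_le_right _ _)⟩
  · intro C hC
    have h1 : ∀ᶠ N in atTop, ∀ i, ‖cocycleProd C i N‖ < 1 / 4 := by
      rw [eventually_all]
      intro i
      have := (h C hC i).norm
      rw [norm_zero] at this
      exact this.eventually_lt_const (by norm_num)
    obtain ⟨N, hN, hN1⟩ := (h1.and (eventually_ge_atTop 1)).exists
    have h2 : ∀ᶠ δ in 𝓝[>] (0 : ℝ), ∀ (i : ZMod n) (X : ℕ → R),
        (∀ j < N, ‖X j - C (i + j)‖ < δ) →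
        ‖seqProd X N - seqProd (fun j => C (i + j)) N‖ < 1 / 4 := by
      rw [eventually_all]
      exact fun i => eventually_seqProd_near _ N (by norm_num)
    obtain ⟨δ, hδ, hδ0⟩ := (h2.and self_mem_nhdsWithin).exists
    refine ⟨Metric.ball C (δ / 2),
      mem_nhdsWithin_of_mem_nhds (Metric.ball_mem_nhds _ (by linarith)),
      N, δ / 2, by linarith, fun C' hC' => ⟨N, hN1, le_rfl, fun i X hX => ?_⟩⟩
    have h3 := hδ i X fun j hj => by
      have h4 := norm_le_pi_norm (C' - C) (i + j)
      rw [Metric.mem_ball, dist_eq_norm] at hC'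
      rw [Pi.sub_apply] at h4
      have h5 := norm_sub_le_norm_sub_add_norm_sub (X j) (C' (i + j)) (C (i + j))
      linarith [hX j hj]
    have h6 := hN i
    rw [cocycleProd] at h6
    have h7 := norm_le_norm_add_norm_sub' (seqProd X N) (seqProd (fun j => C (i + j)) N)
    linarith

end SequenceProducts

section Orbits

/-- The fibre coordinate of the orbit of `(x, i)` under the induced map. -/
def orbitPt (n : ℕ) (f : ZMod n → E2 → E2) (i : ZMod n) (x : E2) (m : ℕ) : E2 :=
  ((step n f)^[m] (x, i)).1

theorem step_iterate_snd {n : ℕ} (f : ZMod n → E2 → E2) (p : E2 × ZMod n) (m : ℕ) :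
    ((step n f)^[m] p).2 = p.2 + m := by
  induction m with
  | zero => simp
  | succ m ih => rw [Function.iterate_succ_apply', step, ih]; push_cast; ring

theorem orbitPt_zero {n : ℕ} (f : ZMod n → E2 → E2) (i : ZMod n) (x : E2) :
    orbitPt n f i x 0 = x := rfl

theorem orbitPt_succ {n : ℕ} (f : ZMod n → E2 → E2) (i : ZMod n) (x : E2) (m : ℕ) :
    orbitPt n f i x (m + 1) = f (i + m) (orbitPt n f i x m) := by
  rw [orbitPt, Function.iterate_succ_apply', step, step_iterate_snd, orbitPt]

theorem orbitPt_add {n : ℕ} (f : ZMod n → E2 → E2) (i : ZMod n) (x : E2) (a b : ℕ) :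
    orbitPt n f i x (a + b) = orbitPt n f (i + a) (orbitPt n f i x a) b := by
  induction b with
  | zero => rfl
  | succ b ih => rw [← add_assoc, orbitPt_succ, ih, orbitPt_succ]; push_cast; rw [add_assoc]

theorem orbitPt_eq_seqProd {n : ℕ} {f : ZMod n → E2 → E2} {i : ZMod n} {x : E2}
    (X : ℕ → E2 →L[ℝ] E2) {m : ℕ}
    (h : ∀ j < m, f (i + j) (orbitPt n f i x j) = X j (orbitPt n f i x j)) :
    orbitPt n f i x m = seqProd X m x := by
  induction m with
  | zero => rfl
  | succ m ih =>
    rw [orbitPt_succ, h m (by omega), ih fun j hj => h j (by omega), seqProd]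
    rfl

theorem norm_orbitPt_le {n : ℕ} {f : ZMod n → E2 → E2} {K : ℝ}
    (hK : 0 ≤ K) (h : ∀ i x, ‖f i x‖ ≤ K * ‖x‖) (i : ZMod n) (x : E2) (m : ℕ) :
    ‖orbitPt n f i x m‖ ≤ K ^ m * ‖x‖ := by
  induction m with
  | zero => simp [orbitPt_zero]
  | succ m ih =>
    rw [orbitPt_succ, pow_succ', mul_assoc]
    exact (h _ _).trans (by gcongr)

theorem norm_le_norm_orbitPt {n : ℕ} {f : ZMod n → E2 → E2} {K : ℝ}
    (hK : 0 ≤ K) (h : ∀ i x, ‖x‖ ≤ K * ‖f i x‖) (i : ZMod n) (x : E2) (m : ℕ) :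
    ‖x‖ ≤ K ^ m * ‖orbitPt n f i x m‖ := by
  induction m with
  | zero => simp [orbitPt_zero]
  | succ m ih =>
    refine ih.trans ?_
    rw [orbitPt_succ, pow_succ, mul_assoc]
    gcongr
    exact h _ _

/-- If every orbit segment starting outside the ball of radius `s` gets halved, every orbit enters
that ball. -/
theorem exists_norm_orbitPt_lt {n : ℕ} {f : ZMod n → E2 → E2} {s : ℝ} (hs : 0 < s)
    (h : ∀ i x, s ≤ ‖x‖ → ∃ N, ‖orbitPt n f i x N‖ ≤ 1 / 2 * ‖x‖) (i : ZMod n) (x : E2) :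
    ∃ m, ‖orbitPt n f i x m‖ < s := by
  by_contra! hcon
  have key : ∀ k : ℕ, ∃ m, ‖orbitPt n f i x m‖ ≤ (1 / 2) ^ k * ‖x‖ := by
    intro k
    induction k with
    | zero => exact ⟨0, by simp [orbitPt_zero]⟩
    | succ k ih =>
      obtain ⟨m, hm⟩ := ih
      obtain ⟨N, hN⟩ := h (i + m) _ (hcon m)
      refine ⟨m + N, ?_⟩
      rw [orbitPt_add, pow_succ', mul_assoc]
      exact hN.trans (by gcongr)
  have ht : Tendsto (fun k : ℕ => (1 / 2 : ℝ) ^ k * ‖x‖) atTop (𝓝 (0 * ‖x‖)) :=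
    (tendsto_pow_atTop_nhds_zero_of_lt_one (by norm_num) (by norm_num)).mul_const _
  rw [zero_mul] at ht
  obtain ⟨k, hk⟩ := (ht.eventually_lt_const hs).exists
  obtain ⟨m, hm⟩ := key k
  linarith [hcon m]

theorem isContractingCocycle_of_eventually {n : ℕ} {f : ZMod n → E2 → E2}
    (h : ∀ i x, ∃ m, Tendsto (orbitPt n f (i + (m : ℕ)) (orbitPt n f i x m)) atTop (𝓝 0)) :
    IsContractingCocycle n f := by
  rintro ⟨x, i⟩
  obtain ⟨m, hm⟩ := h i x
  rw [← tendsto_add_atTop_iff_nat m]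
  refine hm.congr fun k => ?_
  rw [← orbitPt_add, add_comm]
  rfl

/-- A cocycle all of whose orbits get halved within a bounded time is contracting. -/
theorem isContractingCocycle_of_uniform {n : ℕ} {f : ZMod n → E2 → E2} {K : ℝ} (hK : 1 ≤ K)
    (hup : ∀ i x, ‖f i x‖ ≤ K * ‖x‖) {T : ℕ}
    (h : ∀ i x, ∃ N, 1 ≤ N ∧ N ≤ T ∧ ‖orbitPt n f i x N‖ ≤ 1 / 2 * ‖x‖) :
    IsContractingCocycle n f := by
  have hbound : ∀ m i x, ‖orbitPt n f i x m‖ ≤ K ^ T * ‖x‖ := by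
    intro m
    induction m using Nat.strong_induction_on with
    | _ m ih =>
      intro i x
      obtain ⟨N, hN1, hNT, hN⟩ := h i x
      rcases le_or_gt m N with hm | hm
      · refine (norm_orbitPt_le (by linarith) hup i x m).trans ?_
        gcongr
        exact hm.trans hNT
      · obtain ⟨k, rfl⟩ := Nat.exists_eq_add_of_le hm.le
        rw [orbitPt_add]
        refine (ih k (by omega) _ _).trans ?_
        gcongr
        linarith [norm_nonneg x]
  have hK0 : 0 < K ^ T := by positivity
  rintro ⟨x, i⟩
  rw [Metric.tendsto_atTop]
  intro e he
  obtain ⟨m, hm⟩ := exists_norm_orbitPt_lt (div_pos he hK0)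
    (fun i x _ => (h i x).imp fun N hN => hN.2.2) i x
  refine ⟨m, fun k hk => ?_⟩
  obtain ⟨l, rfl⟩ := Nat.exists_eq_add_of_le hk
  rw [dist_zero_right]
  change ‖orbitPt n f i x (m + l)‖ < e
  rw [orbitPt_add]
  refine (hbound _ _ _).trans_lt ?_
  rw [lt_div_iff₀ hK0] at hm
  linarith

/-- Where a radial cocycle varies slowly near a set of uniformly contracting linear cocycles,
orbit segments get halved within a bounded time. -/
theorem exists_norm_orbitPt_le_half {n : ℕ} {D : ℝ → ZMod n → E2 →L[ℝ] E2} {K : ℝ} (hK : 1 ≤ K)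
    (hup : ∀ σ i v, ‖D σ i v‖ ≤ K * ‖v‖) (hlow : ∀ σ i v, ‖v‖ ≤ K * ‖D σ i v‖)
    {Γ : Set (ZMod n → E2 →L[ℝ] E2)} {T : ℕ} {δ : ℝ}
    (hT : ∀ C ∈ Γ, ∃ N, 1 ≤ N ∧ N ≤ T ∧ ∀ (i : ZMod n) (X : ℕ → E2 →L[ℝ] E2),
      (∀ j < N, ‖X j - C (i + j)‖ < δ) → ‖seqProd X N‖ ≤ 1 / 2)
    {S : ℝ} (hS : 0 < S)
    (hΓ : ∀ σ, S ≤ σ → ∃ C ∈ Γ, ∀ σ', S ≤ σ' →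
      |Real.log σ' - Real.log σ| ≤ 2 * T * Real.log K → ∀ i, ‖D σ' i - C i‖ < δ)
    (i : ZMod n) (x : E2) (hx : S * K ^ (2 * T) ≤ ‖x‖ ^ 2) :
    ∃ N, 1 ≤ N ∧ N ≤ T ∧
      ‖orbitPt n (fun i => radialMap fun σ => D σ i) i x N‖ ≤ 1 / 2 * ‖x‖ := by
  set f : ZMod n → E2 → E2 := fun i => radialMap fun σ => D σ i with hf
  have hup' : ∀ i x, ‖f i x‖ ≤ K * ‖x‖ := fun i x => hup _ i x
  have hlow' : ∀ i x, ‖x‖ ≤ K * ‖f i x‖ := fun i x => hlow _ i x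
  have hK0 : 0 ≤ K := by linarith
  have hKT : 1 ≤ K ^ (2 * T) := one_le_pow₀ hK
  have hxS : S ≤ ‖x‖ ^ 2 := le_trans (le_mul_of_one_le_right hS.le hKT) hx
  obtain ⟨C, hC, hCD⟩ := hΓ _ hxS
  obtain ⟨N, hN1, hNT, hN⟩ := hT C hC
  refine ⟨N, hN1, hNT, ?_⟩
  have hx2 : 0 < ‖x‖ ^ 2 := hS.trans_le hxS
  have hlog : Real.log (K ^ (2 * T)) = 2 * T * Real.log K := by
    rw [Real.log_pow]; push_cast; ring
  have hclose : ∀ j < N, ‖D (‖orbitPt n f i x j‖ ^ 2) (i + j) - C (i + j)‖ < δ := by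
    intro j hj
    have hpow : K ^ j ≤ K ^ T := pow_le_pow_right₀ hK (by omega)
    have h1 : ‖orbitPt n f i x j‖ ≤ K ^ T * ‖x‖ :=
      (norm_orbitPt_le hK0 hup' i x j).trans (by gcongr)
    have h2 : ‖x‖ ≤ K ^ T * ‖orbitPt n f i x j‖ :=
      (norm_le_norm_orbitPt hK0 hlow' i x j).trans (by gcongr)
    have h1' : ‖orbitPt n f i x j‖ ^ 2 ≤ K ^ (2 * T) * ‖x‖ ^ 2 := by
      rw [mul_comm 2 T, pow_mul, ← mul_pow]
      gcongr
    have h2' : ‖x‖ ^ 2 ≤ K ^ (2 * T) * ‖orbitPt n f i x j‖ ^ 2 := by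
      rw [mul_comm 2 T, pow_mul, ← mul_pow]
      gcongr
    have hKp : 0 < K ^ (2 * T) := by linarith
    have hy : S ≤ ‖orbitPt n f i x j‖ ^ 2 := by
      refine le_of_mul_le_mul_left ?_ hKp
      linarith
    have hy0 : 0 < ‖orbitPt n f i x j‖ ^ 2 := hS.trans_le hy
    refine hCD _ hy ?_ _
    have l1 := Real.log_le_log hy0 h1'
    have l2 := Real.log_le_log hx2 h2'
    rw [Real.log_mul hKp.ne' hx2.ne', hlog] at l1
    rw [Real.log_mul hKp.ne' hy0.ne', hlog] at l2
    rw [abs_le]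
    constructor <;> linarith
  rw [orbitPt_eq_seqProd (fun j => D (‖orbitPt n f i x j‖ ^ 2) (i + j)) fun j _ => rfl]
  exact ContinuousLinearMap.le_of_opNorm_le _ (hN i _ hclose) x

/-- Orbits of `x ↦ φ(‖x‖²) C x` converge to `0` if the products of `C` are bounded and
`φ < 1` off the origin. -/
theorem tendsto_orbitPt_of_scalar {n : ℕ} {f : ZMod n → E2 → E2} {C : ZMod n → E2 →L[ℝ] E2}
    {φ : ℝ → ℝ} {S M : ℝ} (hM : ∀ i N, ‖cocycleProd C i N‖ ≤ M) (hφc : Continuous φ)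
    (hφ0 : ∀ σ, 0 < φ σ) (hφ1 : ∀ σ, φ σ ≤ 1) (hφ : ∀ σ, 0 < σ → φ σ < 1)
    (hf : ∀ i x, ‖x‖ ^ 2 ≤ S → f i x = φ (‖x‖ ^ 2) • C i x)
    (i : ZMod n) (x : E2) (hx : M ^ 2 * ‖x‖ ^ 2 ≤ S) :
    Tendsto (orbitPt n f i x) atTop (𝓝 0) := by
  have hM0 : 0 ≤ M := (norm_nonneg _).trans (hM i 0)
  set σ : ℕ → ℝ := fun m => ‖orbitPt n f i x m‖ ^ 2 with hσ
  set π : ℕ → ℝ := fun m => ∏ j ∈ Finset.range m, φ (σ j) with hπ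
  have hπ0 : ∀ m, 0 < π m := fun m => Finset.prod_pos fun j _ => hφ0 _
  have hπs : ∀ m, π (m + 1) = π m * φ (σ m) := fun m => Finset.prod_range_succ _ _
  have hπ1 : ∀ m, π m ≤ 1 := fun m => Finset.prod_le_one (fun j _ => (hφ0 _).le) fun j _ => hφ1 _
  have hPx : ∀ m, ‖cocycleProd C i m x‖ ≤ M * ‖x‖ := fun m =>
    (cocycleProd C i m).le_of_opNorm_le (hM i m) x
  have hσS : ∀ m, orbitPt n f i x m = π m • cocycleProd C i m x → σ m ≤ S := by
    intro m hm
    refine le_trans ?_ hx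
    rw [← mul_pow, hσ]
    refine pow_le_pow_left₀ (norm_nonneg _) ?_ 2
    rw [hm, norm_smul, Real.norm_of_nonneg (hπ0 m).le]
    exact (mul_le_of_le_one_left (norm_nonneg _) (hπ1 m)).trans (hPx m)
  have horb : ∀ m, orbitPt n f i x m = π m • cocycleProd C i m x := by
    intro m
    induction m with
    | zero => simp [hπ, orbitPt_zero, cocycleProd, seqProd]
    | succ m ih =>
      rw [orbitPt_succ, hf _ _ (hσS m ih), hπs]
      nth_rewrite 2 [ih]
      rw [map_smul, smul_smul, mul_comm (π m)]
      rfl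
  have hanti : Antitone π := antitone_nat_of_succ_le fun m => by
    rw [hπs]
    exact mul_le_of_le_one_right (hπ0 m).le (hφ1 _)
  have hlim := tendsto_atTop_ciInf hanti ⟨0, by rintro _ ⟨m, rfl⟩; exact (hπ0 m).le⟩
  set p := ⨅ m, π m
  have hp0 : 0 ≤ p := ge_of_tendsto' hlim fun m => (hπ0 m).le
  rcases hp0.eq_or_lt with hp | hp
  · rw [← hp] at hlim
    have h1 := hlim.mul_const (M * ‖x‖)
    rw [zero_mul] at h1
    refine squeeze_zero_norm (fun m => ?_) h1
    rw [horb, norm_smul, Real.norm_of_nonneg (hπ0 m).le]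
    exact mul_le_mul_of_nonneg_left (hPx m) (hπ0 m).le
  · have hφlim : Tendsto (fun m => φ (σ m)) atTop (𝓝 1) := by
      have h1 := (hlim.comp (tendsto_add_atTop_nat 1)).div hlim hp.ne'
      rw [div_self hp.ne'] at h1
      refine h1.congr fun m => ?_
      simp only [Function.comp_apply, hπs, Pi.div_apply]
      rw [mul_div_cancel_left₀ _ (hπ0 m).ne']
    have hσlim : Tendsto σ atTop (𝓝 0) := by
      rw [Metric.tendsto_atTop']
      intro e he
      by_cases hne : (Set.Icc e S).Nonempty
      · obtain ⟨t, ht, hmax⟩ := isCompact_Icc.exists_isMaxOn hne hφc.continuousOn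
        obtain ⟨m, hm⟩ := eventually_atTop.1
          (hφlim.eventually_const_lt (hφ t (he.trans_le ht.1)))
        refine ⟨m, fun k hk => ?_⟩
        rw [Real.dist_0_eq_abs, abs_of_nonneg (sq_nonneg _)]
        by_contra! hcon
        exact absurd (hm k hk.le) (not_lt.2 (hmax ⟨hcon, hσS k (horb k)⟩))
      · refine ⟨0, fun k _ => ?_⟩
        rw [Real.dist_0_eq_abs, abs_of_nonneg (sq_nonneg _)]
        by_contra! hcon
        exact hne ⟨σ k, hcon, hσS k (horb k)⟩
    have h2 := hσlim.sqrt
    rw [Real.sqrt_zero] at h2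
    refine squeeze_zero_norm (fun m => ?_) h2
    rw [hσ, Real.sqrt_sq (norm_nonneg _)]

end Orbits

section PlanarLinearAlgebra

theorem pow_eq_of_quadratic {R : Type*} [Ring R] [Algebra ℝ R] {T : R} {a b : ℝ} (hab : a ≠ b)
    (hT : T * T = (a + b) • T - (a * b) • (1 : R)) (m : ℕ) :
    T ^ m = ((a ^ m - b ^ m) / (a - b)) • T - ((a ^ m * b - b ^ m * a) / (a - b)) • (1 : R) := by
  have h : a - b ≠ 0 := sub_ne_zero.2 hab
  induction m with
  | zero =>
    have h1 : (a ^ 0 * b - b ^ 0 * a) / (a - b) = -1 := by field_simp; ring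
    rw [h1]
    simp
  | succ m ih =>
    rw [pow_succ, ih, sub_mul, smul_mul_assoc, smul_mul_assoc, hT, one_mul, smul_sub, smul_smul,
      smul_smul]
    match_scalars <;> field_simp <;> ring

theorem tendsto_pow_of_quadratic {R : Type*} [NormedRing R] [NormedAlgebra ℝ R] {T : R} {a b : ℝ}
    (hab : a ≠ b) (ha : |a| < 1) (hb : |b| < 1)
    (hT : T * T = (a + b) • T - (a * b) • (1 : R)) : Tendsto (fun m => T ^ m) atTop (𝓝 0) := by
  have h1 := tendsto_pow_atTop_nhds_zero_of_abs_lt_one ha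
  have h2 := tendsto_pow_atTop_nhds_zero_of_abs_lt_one hb
  have h3 := (((h1.sub h2).div_const (a - b)).smul_const T).sub
    ((((h1.mul_const b).sub (h2.mul_const a)).div_const (a - b)).smul_const (1 : R))
  simp only [sub_zero, zero_mul, zero_div, zero_smul] at h3
  exact h3.congr fun m => (pow_eq_of_quadratic hab hT m).symm

theorem exists_bound_pow_of_quadratic {R : Type*} [NormedRing R] [NormedAlgebra ℝ R] {T : R}
    {a b : ℝ} (hab : a ≠ b) (ha : |a| ≤ 1) (hb : |b| ≤ 1)
    (hT : T * T = (a + b) • T - (a * b) • (1 : R)) : ∃ c, ∀ m, ‖T ^ m‖ ≤ c := by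
  refine ⟨2 / |a - b| * ‖T‖ + 2 / |a - b| * ‖(1 : R)‖, fun m => ?_⟩
  have h1 : |a ^ m| ≤ 1 := by rw [abs_pow]; exact pow_le_one₀ (abs_nonneg _) ha
  have h2 : |b ^ m| ≤ 1 := by rw [abs_pow]; exact pow_le_one₀ (abs_nonneg _) hb
  rw [pow_eq_of_quadratic hab hT m]
  refine (norm_sub_le _ _).trans ?_
  rw [norm_smul, norm_smul, Real.norm_eq_abs, Real.norm_eq_abs, abs_div, abs_div]
  gcongr
  · exact (abs_sub _ _).trans (by linarith)
  · refine (abs_sub _ _).trans ?_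
    rw [abs_mul, abs_mul]
    nlinarith [abs_nonneg a, abs_nonneg b, abs_nonneg (a ^ m), abs_nonneg (b ^ m)]

theorem mCLM_mul (A B : M2) : mCLM (A * B) = mCLM A * mCLM B := by simp [mCLM]

theorem mCLM_one : mCLM 1 = 1 := by simp [mCLM]

theorem mCLM_smul (c : ℝ) (A : M2) : mCLM (c • A) = c • mCLM A := by simp [mCLM]

theorem mCLM_sub (A B : M2) : mCLM (A - B) = mCLM A - mCLM B := by simp [mCLM]

/-- The matrix of a continuous linear map of Euclidean `ℝ²`. -/
noncomputable def toM2 : (E2 →L[ℝ] E2) →ₗ[ℝ] M2 :=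
  (Matrix.toEuclideanCLM (n := Fin 2) (𝕜 := ℝ)).symm.toAlgEquiv.toLinearMap

theorem mCLM_toM2 (T : E2 →L[ℝ] E2) : mCLM (toM2 T) = T :=
  (Matrix.toEuclideanCLM (n := Fin 2) (𝕜 := ℝ)).apply_symm_apply T

theorem toM2_mCLM (A : M2) : toM2 (mCLM A) = A :=
  (Matrix.toEuclideanCLM (n := Fin 2) (𝕜 := ℝ)).symm_apply_apply A

theorem continuous_toM2 : Continuous toM2 := toM2.continuous_of_finiteDimensional

theorem continuous_mCLM : Continuous mCLM :=
  (Matrix.toEuclideanCLM (n := Fin 2) (𝕜 := ℝ)).toAlgEquiv.toLinearMap.continuous_of_finiteDimensional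

theorem mCLM_cocProd {n : ℕ} (C : ZMod n → M2) :
    mCLM (cocProd n C) = cocycleProd (fun i => mCLM (C i)) 0 n := by
  have h : cocProd n C = seqProd (fun j => C (j : ZMod n)) n := by
    have hl : ∀ l : List ℕ, (l.flatMap fun a => [((a : ℕ) : ZMod n)]) = l.map (↑) := fun l =>
      List.map_eq_flatMap.symm
    rw [← list_prod_eq_seqProd, cocProd]
    simp [hl, Function.comp_def]
  rw [h, cocycleProd]
  have := map_seqProd (⟨⟨mCLM, mCLM_one⟩, mCLM_mul⟩ : M2 →* (E2 →L[ℝ] E2))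
    (fun j => C (j : ZMod n)) n
  simpa using this

theorem isUnit_mCLM {A : M2} (h : IsUnit A) : IsUnit (mCLM A) :=
  h.map (⟨⟨mCLM, mCLM_one⟩, mCLM_mul⟩ : M2 →* (E2 →L[ℝ] E2))

theorem isUnit_toM2 {T : E2 →L[ℝ] E2} (h : IsUnit T) : IsUnit (toM2 T) :=
  h.map (Matrix.toEuclideanCLM (n := Fin 2) (𝕜 := ℝ)).symm

theorem mul_self_fin_two (A : M2) : A * A = A.trace • A - A.det • (1 : M2) := by
  ext i j
  fin_cases i <;> fin_cases j <;>
    simp [Matrix.mul_apply, Matrix.trace_fin_two, Matrix.det_fin_two] <;> ring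

theorem mCLM_mul_self {A : M2} {a b : ℝ} (ht : A.trace = a + b) (hd : A.det = a * b) :
    mCLM A * mCLM A = (a + b) • mCLM A - (a * b) • (1 : E2 →L[ℝ] E2) := by
  rw [← mCLM_mul, mul_self_fin_two, mCLM_sub, mCLM_smul, mCLM_smul, mCLM_one, ht, hd]

theorem isRoot_charpoly_fin_two {A : M2} {a : ℝ} :
    A.charpoly.IsRoot a ↔ a ^ 2 - A.trace * a + A.det = 0 := by
  rw [Matrix.charpoly_fin_two]
  simp [Polynomial.IsRoot]

theorem trace_det_of_charpoly_eq {A : M2} {a b : ℝ}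
    (h : A.charpoly = (Polynomial.X - Polynomial.C a) * (Polynomial.X - Polynomial.C b)) :
    A.trace = a + b ∧ A.det = a * b := by
  rw [Matrix.charpoly_fin_two] at h
  have h0 := congrArg (Polynomial.eval 0) h
  have h1 := congrArg (Polynomial.eval 1) h
  simp at h0 h1
  constructor <;> nlinarith

theorem hasEigenvalue_mCLM {A : M2} {a : ℝ} (h : a ^ 2 - A.trace * a + A.det = 0) :
    Module.End.HasEigenvalue (ContinuousLinearMap.toLinearMap (mCLM A)) a := by
  have hdet : (A - a • (1 : M2)).det = 0 := by
    rw [← h]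
    simp [Matrix.det_fin_two, Matrix.trace_fin_two]
    ring
  obtain ⟨v, hv, hAv⟩ := Matrix.exists_mulVec_eq_zero_iff.2 hdet
  rw [Matrix.sub_mulVec, Matrix.smul_mulVec, Matrix.one_mulVec, sub_eq_zero] at hAv
  refine Module.End.hasEigenvalue_of_hasEigenvector (x := WithLp.toLp 2 v)
    ⟨Module.End.mem_eigenspace_iff.2 ?_, ?_⟩
  · apply (WithLp.equiv 2 _).injective
    simpa [mCLM] using hAv
  · simpa using hv

/-- Both eigenvalues are real, positive and distinct. -/
def HasPositiveSimpleSpectrum (A : M2) : Prop :=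
  0 < A.trace ∧ 0 < A.det ∧ 4 * A.det < A.trace ^ 2

theorem hasPositiveSimpleSpectrum_of_roots {A : M2} {a b : ℝ} (hb : 0 < b) (hab : b < a)
    (ht : A.trace = a + b) (hd : A.det = a * b) : HasPositiveSimpleSpectrum A := by
  refine ⟨by rw [ht]; linarith, by rw [hd]; exact mul_pos (hb.trans hab) hb, ?_⟩
  rw [ht, hd]
  nlinarith [sq_pos_of_pos (sub_pos.2 hab)]

theorem HasPositiveSimpleSpectrum.smul {A : M2} (h : HasPositiveSimpleSpectrum A) {c : ℝ}
    (hc : 0 < c) : HasPositiveSimpleSpectrum (c • A) := by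
  obtain ⟨h1, h2, h3⟩ := h
  have hc2 : 0 < c ^ 2 := by positivity
  refine ⟨?_, ?_, ?_⟩
  · rw [Matrix.trace_smul, smul_eq_mul]; positivity
  · rw [Matrix.det_smul, Fintype.card_fin]; positivity
  · rw [Matrix.det_smul, Fintype.card_fin, Matrix.trace_smul, smul_eq_mul]
    nlinarith

theorem HasPositiveSimpleSpectrum.exists_eigenvalues {A : M2} (h : HasPositiveSimpleSpectrum A) :
    ∃ μ₁ μ₂ : ℝ, 0 < μ₂ ∧ μ₂ < μ₁ ∧
      Module.End.HasEigenvalue (ContinuousLinearMap.toLinearMap (mCLM A)) μ₁ ∧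
      Module.End.HasEigenvalue (ContinuousLinearMap.toLinearMap (mCLM A)) μ₂ := by
  obtain ⟨h1, h2, h3⟩ := h
  have hpos : 0 < A.trace ^ 2 - 4 * A.det := by linarith
  have hs := Real.sq_sqrt hpos.le
  have hs0 := Real.sqrt_pos.2 hpos
  set s := Real.sqrt (A.trace ^ 2 - 4 * A.det)
  refine ⟨(A.trace + s) / 2, (A.trace - s) / 2, ?_, by linarith, hasEigenvalue_mCLM ?_,
    hasEigenvalue_mCLM ?_⟩
  · have : s < A.trace := lt_of_pow_lt_pow_left₀ 2 h1.le (by linarith)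
    linarith
  · nlinarith
  · nlinarith

theorem isOpen_hasPositiveSimpleSpectrum : IsOpen {A : M2 | HasPositiveSimpleSpectrum A} := by
  have ht : Continuous fun A : M2 => A.trace := continuous_id.matrix_trace
  have hd : Continuous fun A : M2 => A.det := continuous_id.matrix_det
  exact (isOpen_lt continuous_const ht).inter
    ((isOpen_lt continuous_const hd).inter (isOpen_lt (hd.const_mul 4) (ht.pow 2)))

theorem continuous_cocycleProd {n : ℕ} (i : ZMod n) (N : ℕ) :
    Continuous fun C : ZMod n → E2 →L[ℝ] E2 => cocycleProd C i N := by
  induction N with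
  | zero => exact continuous_const
  | succ N ih => exact (continuous_apply _).mul ih

end PlanarLinearAlgebra

section Profile

theorem deriv_smoothTransition_eq_zero {x : ℝ} (hx : x ∉ Set.Icc (0 : ℝ) 1) :
    deriv Real.smoothTransition x = 0 := by
  rcases lt_or_ge x 0 with h | h
  · have : Real.smoothTransition =ᶠ[𝓝 x] fun _ => 0 := by
      filter_upwards [Iio_mem_nhds h] with y hy
      exact Real.smoothTransition.zero_of_nonpos (le_of_lt hy)
    rw [this.deriv_eq, deriv_const]
  · have h1 : 1 < x := by
      by_contra! hcon
      exact hx ⟨h, hcon⟩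
    have : Real.smoothTransition =ᶠ[𝓝 x] fun _ => 1 := by
      filter_upwards [Ioi_mem_nhds h1] with y hy
      exact Real.smoothTransition.one_of_one_le (le_of_lt hy)
    rw [this.deriv_eq, deriv_const]

theorem exists_bound_deriv_smoothTransition : ∃ L : ℝ, 0 < L ∧
    (∀ x, |deriv Real.smoothTransition x| ≤ L) ∧
    ∀ x, |x| * |deriv Real.smoothTransition x| ≤ L := by
  have hc : Continuous (deriv Real.smoothTransition) :=
    (Real.smoothTransition.contDiff (n := 1)).continuous_deriv le_rfl
  obtain ⟨L, hL⟩ := isCompact_Icc.exists_bound_of_continuousOn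
    (hc.continuousOn (s := Set.Icc (0 : ℝ) 1))
  have hL' : ∀ x ∈ Set.Icc (0 : ℝ) 1, |deriv Real.smoothTransition x| ≤ max L 1 := fun x hx =>
    (hL x hx).trans (le_max_left _ _)
  have h1 : (0 : ℝ) < max L 1 := lt_max_of_lt_right one_pos
  refine ⟨max L 1, h1, fun x => ?_, fun x => ?_⟩ <;> by_cases hx : x ∈ Set.Icc (0 : ℝ) 1
  · exact hL' x hx
  · rw [deriv_smoothTransition_eq_zero hx, abs_zero]; exact h1.le
  · refine (mul_le_of_le_one_left (abs_nonneg _) ?_).trans (hL' x hx)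
    rw [abs_of_nonneg hx.1]; exact hx.2
  · rw [deriv_smoothTransition_eq_zero hx, abs_zero, mul_zero]; exact h1.le

/-- A smooth step in logarithmic scale, with speed `η`. -/
noncomputable def logStep (η c σ : ℝ) : ℝ :=
  if σ ≤ 0 then 0 else Real.smoothTransition (η * Real.log σ + c)

theorem logStep_of_pos {η c σ : ℝ} (hσ : 0 < σ) :
    logStep η c σ = Real.smoothTransition (η * Real.log σ + c) := if_neg hσ.not_ge

theorem logStep_eq_zero {η c σ : ℝ} (hη : 0 < η) (hσ : σ ≤ Real.exp (-c / η)) :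
    logStep η c σ = 0 := by
  rcases le_or_gt σ 0 with h | h
  · exact if_pos h
  · rw [logStep_of_pos h]
    refine Real.smoothTransition.zero_of_nonpos ?_
    have := (Real.log_le_iff_le_exp h).2 hσ
    rw [le_div_iff₀ hη] at this
    linarith

theorem logStep_eq_one {η c σ : ℝ} (hη : 0 < η) (hσ : Real.exp ((1 - c) / η) ≤ σ) :
    logStep η c σ = 1 := by
  have h : 0 < σ := (Real.exp_pos _).trans_le hσ
  rw [logStep_of_pos h]
  refine Real.smoothTransition.one_of_one_le ?_
  have := (Real.le_log_iff_exp_le h).2 hσ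
  rw [div_le_iff₀ hη] at this
  linarith

theorem logStep_nonneg (η c σ : ℝ) : 0 ≤ logStep η c σ := by
  unfold logStep
  split_ifs
  exacts [le_rfl, Real.smoothTransition.nonneg _]

theorem logStep_le_one (η c σ : ℝ) : logStep η c σ ≤ 1 := by
  unfold logStep
  split_ifs
  exacts [zero_le_one, Real.smoothTransition.le_one _]

theorem logStep_eventuallyEq_zero {η c σ : ℝ} (hη : 0 < η) (hσ : σ ≤ 0) :
    logStep η c =ᶠ[𝓝 σ] fun _ => 0 := by
  filter_upwards [Iio_mem_nhds (hσ.trans_lt (Real.exp_pos (-c / η)))] with y hy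
  exact logStep_eq_zero hη (le_of_lt hy)

theorem logStep_eventuallyEq {η c σ : ℝ} (hσ : 0 < σ) :
    logStep η c =ᶠ[𝓝 σ] fun σ => Real.smoothTransition (η * Real.log σ + c) := by
  filter_upwards [Ioi_mem_nhds hσ] with y hy
  exact logStep_of_pos hy

theorem contDiff_logStep {η : ℝ} (c : ℝ) (hη : 0 < η) : ContDiff ℝ 1 (logStep η c) := by
  rw [contDiff_iff_contDiffAt]
  intro σ
  rcases le_or_gt σ 0 with h | h
  · exact contDiffAt_const.congr_of_eventuallyEq (logStep_eventuallyEq_zero hη h)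
  · refine ContDiffAt.congr_of_eventuallyEq ?_ (logStep_eventuallyEq h)
    exact (Real.smoothTransition.contDiffAt (n := 1)).comp σ
      ((contDiffAt_const.mul (Real.contDiffAt_log.2 h.ne')).add contDiffAt_const)

theorem abs_mul_deriv_logStep_le {η : ℝ} (c : ℝ) (hη : 0 < η) {L : ℝ}
    (hL : ∀ x, |deriv Real.smoothTransition x| ≤ L) (σ : ℝ) :
    |σ| * |deriv (logStep η c) σ| ≤ η * L := by
  have hL0 : 0 ≤ L := (abs_nonneg _).trans (hL 0)
  rcases le_or_gt σ 0 with h | h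
  · rw [(logStep_eventuallyEq_zero hη h).deriv_eq, deriv_const, abs_zero, mul_zero]
    positivity
  · rw [(logStep_eventuallyEq h).deriv_eq]
    have h1 : HasDerivAt (fun σ => η * Real.log σ + c) (η * σ⁻¹) σ :=
      ((Real.hasDerivAt_log h.ne').const_mul η).add_const c
    have h2 := ((Real.smoothTransition.contDiff (n := 1)).differentiable one_ne_zero
      (η * Real.log σ + c)).hasDerivAt.comp σ h1
    have h3 := h2.deriv
    rw [Function.comp_def] at h3
    rw [h3, ← abs_mul, mul_left_comm, mul_left_comm σ η, mul_inv_cancel₀ h.ne', mul_one,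
      mul_comm, abs_mul, abs_of_pos hη]
    gcongr
    exact hL _

/-- The profile equal to `1` near the origin, to `-1` on a middle zone and to `0` for `σ ≥ 1`,
which varies with speed `η` in logarithmic scale. -/
noncomputable def profile (η σ : ℝ) : ℝ := 1 - 2 * logStep η 3 σ + logStep η 1 σ

theorem contDiff_profile {η : ℝ} (hη : 0 < η) : ContDiff ℝ 1 (profile η) :=
  (contDiff_const.sub (contDiff_const.mul (contDiff_logStep 3 hη))).add (contDiff_logStep 1 hη)

theorem rate_profile_le {η : ℝ} (hη : 0 < η) {L : ℝ}
    (hL : ∀ x, |deriv Real.smoothTransition x| ≤ L) (σ : ℝ) :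
    2 * (|σ| * ‖deriv (profile η) σ‖) ≤ 6 * (η * L) := by
  have h3 := ((contDiff_logStep 3 hη).differentiable one_ne_zero σ).hasDerivAt
  have h1 := ((contDiff_logStep 1 hη).differentiable one_ne_zero σ).hasDerivAt
  have h : HasDerivAt (profile η) (-(2 * deriv (logStep η 3) σ) + deriv (logStep η 1) σ) σ :=
    ((h3.const_mul 2).const_sub 1).add h1
  rw [h.deriv, Real.norm_eq_abs]
  have k3 := abs_mul_deriv_logStep_le 3 hη hL σ
  have k1 := abs_mul_deriv_logStep_le 1 hη hL σ
  have h4 := abs_add_le (-(2 * deriv (logStep η 3) σ)) (deriv (logStep η 1) σ)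
  rw [abs_neg, abs_mul, abs_two] at h4
  have h5 := mul_le_mul_of_nonneg_left h4 (abs_nonneg σ)
  linarith

theorem profile_eq_one {η σ : ℝ} (hη : 0 < η) (hσ : σ ≤ Real.exp (-3 / η)) : profile η σ = 1 := by
  have h : σ ≤ Real.exp (-1 / η) := hσ.trans (Real.exp_le_exp.2 (by gcongr; norm_num))
  rw [profile, logStep_eq_zero hη hσ, logStep_eq_zero hη h]
  ring

theorem profile_eq_neg_one {η σ : ℝ} (hη : 0 < η) (h1 : Real.exp (-2 / η) ≤ σ)
    (h2 : σ ≤ Real.exp (-1 / η)) : profile η σ = -1 := by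
  rw [profile, logStep_eq_one hη (by norm_num; exact h1), logStep_eq_zero hη h2]
  ring

theorem profile_eq_zero {η σ : ℝ} (hη : 0 < η) (h : 1 ≤ σ) : profile η σ = 0 := by
  have h3 : Real.exp ((1 - 3) / η) ≤ σ :=
    (Real.exp_le_one_iff.2 (div_nonpos_of_nonpos_of_nonneg (by norm_num) hη.le)).trans h
  rw [profile, logStep_eq_one hη h3, logStep_eq_one hη (by simpa using h)]
  ring

theorem profile_mem_Icc {η : ℝ} (hη : 0 < η) (σ : ℝ) : profile η σ ∈ Set.Icc (-1 : ℝ) 1 := by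
  have a0 := logStep_nonneg η 3 σ
  have a1 := logStep_le_one η 3 σ
  have b0 := logStep_nonneg η 1 σ
  have b1 := logStep_le_one η 1 σ
  rcases le_or_gt σ (Real.exp (-1 / η)) with h | h
  · rw [profile, logStep_eq_zero hη h]
    constructor <;> linarith
  · have : Real.exp ((1 - 3) / η) ≤ σ := (Real.exp_le_exp.2 (by gcongr; norm_num)).trans h.le
    rw [profile, logStep_eq_one hη this]
    constructor <;> linarith

/-- Continuous paths can be approximated by smooth ones with the same values at three points. -/
theorem exists_contDiff_approx_eq {F : Type*} [NormedAddCommGroup F] [NormedSpace ℝ F]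
    {f : ℝ → F} (hf : Continuous f) {e : ℝ} (he : 0 < e) :
    ∃ g : ℝ → F, ContDiff ℝ 1 g ∧ (∀ t, ‖g t - f t‖ < e) ∧
      g (-1) = f (-1) ∧ g 0 = f 0 ∧ g 1 = f 1 := by
  let q : ℝ → F := fun t =>
    (t * (t - 1) / 2) • f (-1) + (1 - t ^ 2) • f 0 + (t * (t + 1) / 2) • f 1
  have hq : ContDiff ℝ 1 q := by fun_prop
  obtain ⟨g, hg, hgf, hsupp⟩ := (hf.sub hq.continuous).exists_contDiff_approx 1
    (continuous_const (y := e)) fun _ => he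
  have hz : ∀ t, f t = q t → (g + q) t = f t := by
    intro t ht
    have : g t = 0 := by
      by_contra hne
      exact hsupp hne (by simp [ht])
    simp [this, ht]
  refine ⟨g + q, hg.add hq, fun t => ?_, hz _ ?_, hz _ ?_, hz _ ?_⟩
  · have := hgf t
    rw [dist_eq_norm] at this
    have h2 : (g + q) t - f t = g t - (f - q) t := by
      simp only [Pi.add_apply, Pi.sub_apply]
      abel
    rwa [h2]
  · simp only [q]; norm_num
  · simp only [q]; norm_num
  · simp only [q]; norm_num

end Profile

section FlexiblePaths

/-- A function nonnegative on `(-1, 1)` and continuous is nonnegative on `[-1, 1]`. -/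
theorem nonneg_of_nonneg_Ioo {f : ℝ → ℝ} (hf : Continuous f)
    (h : ∀ t ∈ Set.Ioo (-1 : ℝ) 1, 0 ≤ f t) {t : ℝ} (ht : t ∈ Set.Icc (-1 : ℝ) 1) : 0 ≤ f t := by
  have hcl : IsClosed {t | 0 ≤ f t} := isClosed_le continuous_const hf
  have : closure (Set.Ioo (-1 : ℝ) 1) ⊆ {t | 0 ≤ f t} := hcl.closure_subset_iff.2 h
  rw [closure_Ioo (by norm_num)] at this
  exact this ht

theorem exists_forall_norm_le_of_isCompact {F : Type*} [NormedAddCommGroup F] {f : ℝ → F}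
    (hf : Continuous f) : ∃ J, 0 < J ∧ ∀ t ∈ Set.Icc (-1 : ℝ) 1, ‖f t‖ ≤ J := by
  obtain ⟨J, hJ⟩ := isCompact_Icc.exists_bound_of_continuousOn hf.continuousOn
  exact ⟨max J 1, by positivity, fun t ht => (hJ t ht).trans (le_max_left _ _)⟩

theorem isUnit_cocProd {n : ℕ} {A : ZMod n → M2} (h : ∀ i, IsUnit (A i)) :
    IsUnit (cocProd n A) := by
  have hl : ∀ l : List M2, (∀ B ∈ l, IsUnit B) → IsUnit l.prod := by
    intro l hl
    induction l with
    | nil => simp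
    | cons B l ih =>
      rw [List.prod_cons]
      exact (hl B (by simp)).mul (ih fun C hC => hl C (by simp [hC]))
  refine hl _ fun B hB => ?_
  simp only [List.mem_reverse, List.mem_map] at hB
  obtain ⟨i, -, rfl⟩ := hB
  exact h _

/-- The operator cocycles underlying a flexible cocycle, with uniform constants. -/
theorem IsFlexible.exists_path {n : ℕ} [NeZero n] {ε : ℝ} {A : ZMod n → M2}
    (hε : 0 < ε) (h : IsFlexible n ε A) :
    ∃ a : ℝ → ZMod n → E2 →L[ℝ] E2, Continuous a ∧ a 0 = (fun i => mCLM (A i)) ∧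
      (∃ ε₀ < ε, ∀ t ∈ Set.Icc (-1 : ℝ) 1, ∀ i, ‖a t i - a 0 i‖ ≤ ε₀) ∧
      (∃ k > 0, ∀ t ∈ Set.Icc (-1 : ℝ) 1, ∀ i v, k * ‖v‖ ≤ ‖a t i v‖) ∧
      (∃ c : ℝ, 0 < c ∧ c < 1 ∧ cocycleProd (a (-1)) 0 n = c • (1 : E2 →L[ℝ] E2)) ∧
      (∀ t ∈ Set.Ioo (-1 : ℝ) 1, ∃ μ₁ μ₂ : ℝ, 0 < μ₂ ∧ μ₂ < μ₁ ∧ μ₁ < 1 ∧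
        (toM2 (cocycleProd (a t) 0 n)).trace = μ₁ + μ₂ ∧
        (toM2 (cocycleProd (a t) 0 n)).det = μ₁ * μ₂) ∧
      ∃ μ : ℝ, 0 < μ ∧ μ < 1 ∧ (toM2 (cocycleProd (a 1) 0 n)).trace = 1 + μ ∧
        (toM2 (cocycleProd (a 1) 0 n)).det = 1 * μ := by
  obtain ⟨Af, hc, hu, hd, h0, ⟨c, hm1⟩, hmid, hsmall, h1⟩ := h
  have hle : (-1 : ℝ) ≤ 1 := by norm_num
  set q : ℝ → ℝ := fun t => Set.projIcc (-1 : ℝ) 1 hle t with hq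
  have hqm : ∀ t, q t ∈ Set.Icc (-1 : ℝ) 1 := fun t => (Set.projIcc (-1 : ℝ) 1 hle t).2
  have hqe : ∀ t ∈ Set.Icc (-1 : ℝ) 1, q t = t := fun t ht => by
    simp only [hq, Set.projIcc_of_mem hle ht]
  have hqc : Continuous q := continuous_subtype_val.comp continuous_projIcc
  set a : ℝ → ZMod n → E2 →L[ℝ] E2 := fun t i => mCLM (Af (q t) i) with ha
  have hac : Continuous a := continuous_pi fun i =>
    continuous_mCLM.comp ((hc i).comp_continuous hqc hqm)
  have hae : ∀ t ∈ Set.Icc (-1 : ℝ) 1, ∀ i, a t i = mCLM (Af t i) := fun t ht i => by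
    simp only [ha, hqe t ht]
  have hz : (0 : ℝ) ∈ Set.Icc (-1 : ℝ) 1 := by norm_num
  have hone : (1 : ℝ) ∈ Set.Icc (-1 : ℝ) 1 := by norm_num
  have hneg : (-1 : ℝ) ∈ Set.Icc (-1 : ℝ) 1 := by norm_num
  have hprod : ∀ t ∈ Set.Icc (-1 : ℝ) 1, toM2 (cocycleProd (a t) 0 n) = cocProd n (Af t) := by
    intro t ht
    have : a t = fun i => mCLM (Af t i) := funext fun i => hae t ht i
    rw [this, ← mCLM_cocProd, toM2_mCLM]
  have hdet : ∀ t ∈ Set.Icc (-1 : ℝ) 1, (cocProd n (Af t)).det ≠ 0 := by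
    intro t ht
    exact ((Matrix.isUnit_iff_isUnit_det _).1 (isUnit_cocProd (hu t ht))).ne_zero
  have hPc : Continuous fun t => toM2 (cocycleProd (a t) 0 n) :=
    continuous_toM2.comp ((continuous_cocycleProd 0 n).comp hac)
  have hmid' : ∀ t ∈ Set.Ioo (-1 : ℝ) 1, ∃ μ₁ μ₂ : ℝ, 0 < μ₂ ∧ μ₂ < μ₁ ∧ μ₁ < 1 ∧
        (toM2 (cocycleProd (a t) 0 n)).trace = μ₁ + μ₂ ∧
        (toM2 (cocycleProd (a t) 0 n)).det = μ₁ * μ₂ := by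
    intro t ht
    obtain ⟨μ₁, μ₂, h2, h12, h1, hch⟩ := hmid t ht
    rw [hprod t (Set.Ioo_subset_Icc_self ht)]
    exact ⟨μ₁, μ₂, h2, h12, h1, trace_det_of_charpoly_eq hch⟩
  have htr0 : ∀ t ∈ Set.Icc (-1 : ℝ) 1, 0 ≤ (cocProd n (Af t)).trace := by
    intro t ht
    rw [← hprod t ht]
    refine nonneg_of_nonneg_Ioo (f := fun t => (toM2 (cocycleProd (a t) 0 n)).trace)
      hPc.matrix_trace (fun s hs => ?_) ht
    obtain ⟨μ₁, μ₂, h2, h12, -, htr, -⟩ := hmid' s hs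
    rw [htr]; linarith
  have hdet0 : ∀ t ∈ Set.Icc (-1 : ℝ) 1, 0 < (cocProd n (Af t)).det := by
    intro t ht
    refine lt_of_le_of_ne ?_ (hdet t ht).symm
    rw [← hprod t ht]
    refine nonneg_of_nonneg_Ioo (f := fun t => (toM2 (cocycleProd (a t) 0 n)).det)
      hPc.matrix_det (fun s hs => ?_) ht
    obtain ⟨μ₁, μ₂, h2, h12, -, -, hd⟩ := hmid' s hs
    rw [hd]
    exact (mul_pos (h2.trans h12) h2).le
  refine ⟨a, hac, ?_, ?_, ?_, ?_, hmid', ?_⟩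
  · funext i
    rw [hae 0 hz, h0]
  · obtain ⟨t₀, ht₀, hmax⟩ := isCompact_Icc.exists_isMaxOn (Set.nonempty_Icc.2 hle)
      (hac.sub continuous_const).norm.continuousOn (f := fun t => ‖a t - a 0‖)
    refine ⟨‖a t₀ - a 0‖, ?_, fun t ht i => (norm_le_pi_norm (a t - a 0) i).trans (hmax ht)⟩
    rw [pi_norm_lt_iff hε]
    intro i
    have := hd t₀ ht₀ 0 hz i
    rwa [mnorm, mCLM_sub, ← hae t₀ ht₀, ← hae 0 hz] at this
  · have hau : ∀ t i, IsUnit (a t i) := fun t i => isUnit_mCLM (hu _ (hqm t) i)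
    have hinv : Continuous fun t => fun i => Ring.inverse (a t i) := by
      refine continuous_pi fun i => continuous_iff_continuousAt.2 fun t => ?_
      obtain ⟨u, hu'⟩ := hau t i
      have h1 := NormedRing.inverse_continuousAt u
      rw [hu'] at h1
      exact ContinuousAt.comp (g := Ring.inverse) (f := fun t => a t i) h1
        ((continuous_apply i).comp hac).continuousAt
    obtain ⟨J, hJ, hb⟩ := exists_forall_norm_le_of_isCompact hinv
    refine ⟨J⁻¹, inv_pos.2 hJ, fun t ht i v => ?_⟩
    rw [inv_mul_le_iff₀ hJ]
    calc ‖v‖ = ‖Ring.inverse (a t i) (a t i v)‖ := by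
          rw [← mul_apply_eq_comp, Ring.inverse_mul_cancel _ (hau t i)]
          rfl
      _ ≤ ‖Ring.inverse (a t i)‖ * ‖a t i v‖ := ContinuousLinearMap.le_opNorm _ _
      _ ≤ J * ‖a t i v‖ := by
          gcongr
          exact (norm_le_pi_norm (fun i => Ring.inverse (a t i)) i).trans (hb t ht)
  · have htr : (cocProd n (Af (-1))).trace = 2 * c := by
      rw [hm1]; simp; ring
    have hdt : (cocProd n (Af (-1))).det = c ^ 2 := by
      rw [hm1]; simp
    obtain ⟨μ, hμ1, hμ, -⟩ := hsmall (-1) hneg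
    rw [isRoot_charpoly_fin_two, htr, hdt] at hμ
    have hμc : μ = c := by
      have : (μ - c) ^ 2 = 0 := by linarith
      linarith [pow_eq_zero_iff (two_ne_zero) |>.1 this]
    have h3 := htr0 (-1) hneg
    have h4 := hdet0 (-1) hneg
    rw [htr] at h3
    rw [hdt] at h4
    refine ⟨c, ?_, hμc ▸ hμ1, ?_⟩
    · rcases (by linarith : (0 : ℝ) ≤ c).eq_or_lt with h5 | h5
      · rw [← h5] at h4; norm_num at h4
      · exact h5
    · rw [← mCLM_toM2 (cocycleProd (a (-1)) 0 n), hprod (-1) hneg, hm1, mCLM_smul, mCLM_one]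
  · rw [isRoot_charpoly_fin_two] at h1
    obtain ⟨μ, hμ1, hμ, -⟩ := hsmall 1 hone
    rw [isRoot_charpoly_fin_two] at hμ
    have h3 := hdet0 1 hone
    rw [hprod 1 hone]
    have hroot : (μ - 1) * (μ - (cocProd n (Af 1)).det) = 0 := by
      linear_combination hμ - μ * h1
    have hμd : μ = (cocProd n (Af 1)).det := by
      rcases mul_eq_zero.1 hroot with h4 | h4 <;> linarith
    exact ⟨μ, hμd ▸ h3, hμ1, by linarith, by linarith⟩

end FlexiblePaths

section DampedPaths

theorem cocycleProd_smul {n : ℕ} (s : ℝ) (C : ZMod n → E2 →L[ℝ] E2)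
    (i : ZMod n) (N : ℕ) :
    cocycleProd (s • C) i N = s ^ N • cocycleProd C i N :=
  seqProd_smul (R := E2 →L[ℝ] E2) s (fun j => C (i + j)) N

theorem tendsto_pow_smul_one {R : Type*} [NormedRing R] [NormedAlgebra ℝ R] {c : ℝ} {T : R}
    (h0 : 0 ≤ c) (h1 : c < 1) (hT : T = c • (1 : R)) : Tendsto (fun m => T ^ m) atTop (𝓝 0) := by
  have h := (tendsto_pow_atTop_nhds_zero_of_lt_one h0 h1).smul_const (1 : R)
  rw [zero_smul] at h
  refine h.congr fun q => ?_
  rw [hT, smul_pow, one_pow]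

theorem trace_det_toM2_smul {C : E2 →L[ℝ] E2} {a b : ℝ} (r : ℝ) (ht : (toM2 C).trace = a + b)
    (hd : (toM2 C).det = a * b) :
    (toM2 (r • C)).trace = r * a + r * b ∧ (toM2 (r • C)).det = (r * a) * (r * b) := by
  rw [map_smul, Matrix.trace_smul, Matrix.det_smul, ht, hd, smul_eq_mul, Fintype.card_fin]
  constructor <;> ring

theorem tendsto_pow_of_trace_det {C : E2 →L[ℝ] E2} {a b : ℝ} (hab : a ≠ b) (ha : |a| < 1)
    (hb : |b| < 1) (ht : (toM2 C).trace = a + b) (hd : (toM2 C).det = a * b) :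
    Tendsto (fun m => C ^ m) atTop (𝓝 0) := by
  have h := mCLM_mul_self ht hd
  rw [mCLM_toM2] at h
  exact tendsto_pow_of_quadratic hab ha hb h

theorem damping_mem {δ t : ℝ} (hδ : 0 < δ) (hδ1 : δ < 1) (ht : t ∈ Set.Icc (-1 : ℝ) 1) :
    1 - δ * t ^ 2 ∈ Set.Ioc (0 : ℝ) 1 ∧ 1 - δ ≤ 1 - δ * t ^ 2 := by
  have h : t ^ 2 ≤ 1 := by nlinarith [ht.1, ht.2]
  have h0 : 0 ≤ t ^ 2 := sq_nonneg t
  refine ⟨⟨?_, ?_⟩, ?_⟩ <;> nlinarith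

/-- Damping a flexible path by `1 - δ t²` makes all its members contracting, including the
end points; the damped path can then be smoothed. -/
theorem exists_damped_path {n : ℕ} [NeZero n] {a : ℝ → ZMod n → E2 →L[ℝ] E2} (hac : Continuous a)
    {c : ℝ} (hc0 : 0 < c) (hc1 : c < 1) (hc : cocycleProd (a (-1)) 0 n = c • (1 : E2 →L[ℝ] E2))
    (hmid : ∀ t ∈ Set.Ioo (-1 : ℝ) 1, ∃ μ₁ μ₂ : ℝ, 0 < μ₂ ∧ μ₂ < μ₁ ∧ μ₁ < 1 ∧
      (toM2 (cocycleProd (a t) 0 n)).trace = μ₁ + μ₂ ∧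
      (toM2 (cocycleProd (a t) 0 n)).det = μ₁ * μ₂)
    {μ : ℝ} (hμ0 : 0 < μ) (hμ1 : μ < 1) (htr : (toM2 (cocycleProd (a 1) 0 n)).trace = 1 + μ)
    (hdet : (toM2 (cocycleProd (a 1) 0 n)).det = 1 * μ)
    {δ e : ℝ} (hδ : 0 < δ) (hδ1 : δ < 1) (he : 0 < e) :
    ∃ P : ℝ → ZMod n → E2 →L[ℝ] E2, ContDiff ℝ 1 P ∧
      (∀ t i, ‖P t i - (1 - δ * t ^ 2) • a t i‖ ≤ e) ∧
      P (-1) = (1 - δ) • a (-1) ∧ P 0 = a 0 ∧ P 1 = (1 - δ) • a 1 ∧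
      (∀ t ∈ Set.Icc (0 : ℝ) 1, HasPositiveSimpleSpectrum (toM2 (cocycleProd (P t) 0 n))) ∧
      ∃ (T : ℕ) (δ₀ : ℝ), 0 < δ₀ ∧ ∀ t ∈ Set.Icc (-1 : ℝ) 1, ∃ N, 1 ≤ N ∧ N ≤ T ∧
        ∀ (i : ZMod n) (X : ℕ → E2 →L[ℝ] E2),
          (∀ j < N, ‖X j - P t (i + j)‖ < δ₀) → ‖seqProd X N‖ ≤ 1 / 2 := by
  have hn : n ≠ 0 := NeZero.ne n
  set b : ℝ → ZMod n → E2 →L[ℝ] E2 := fun t => (1 - δ * t ^ 2) • a t with hb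
  have hbc : Continuous b := (by fun_prop : Continuous fun t : ℝ => 1 - δ * t ^ 2).smul hac
  have hbp : ∀ t, cocycleProd (b t) 0 n = (1 - δ * t ^ 2) ^ n • cocycleProd (a t) 0 n :=
    fun t => cocycleProd_smul _ _ _ _
  have hsn : (1 - δ) ^ n < 1 := pow_lt_one₀ (by linarith) (by linarith) hn
  have hsn0 : 0 < (1 - δ) ^ n := pow_pos (by linarith) n
  have hspec : ∀ t ∈ Set.Ioc (-1 : ℝ) 1, ∃ μ₁ μ₂ : ℝ, 0 < μ₂ ∧ μ₂ < μ₁ ∧ μ₁ < 1 ∧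
      (toM2 (cocycleProd (b t) 0 n)).trace = μ₁ + μ₂ ∧
      (toM2 (cocycleProd (b t) 0 n)).det = μ₁ * μ₂ := by
    intro t ht
    rcases ht.2.eq_or_lt with h1 | h1
    · subst h1
      obtain ⟨h2, h3⟩ := trace_det_toM2_smul ((1 - δ) ^ n) htr hdet
      refine ⟨_, _, mul_pos hsn0 hμ0, mul_lt_mul_of_pos_left hμ1 hsn0, ?_, ?_, ?_⟩
      · rwa [mul_one]
      · rw [hbp]; simpa using h2
      · rw [hbp]; simpa using h3
    · obtain ⟨μ₁, μ₂, h2, h12, hlt, h3, h4⟩ := hmid t ⟨ht.1, h1⟩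
      obtain ⟨hs, -⟩ := damping_mem hδ hδ1 (Set.Ioc_subset_Icc_self ht)
      obtain ⟨h5, h6⟩ := trace_det_toM2_smul ((1 - δ * t ^ 2) ^ n) h3 h4
      have hp := pow_pos hs.1 n
      have hp1 := pow_le_one₀ hs.1.le hs.2 (n := n)
      refine ⟨_, _, mul_pos hp h2, mul_lt_mul_of_pos_left h12 hp, ?_, ?_, ?_⟩
      · nlinarith
      · rw [hbp]; exact h5
      · rw [hbp]; exact h6
  have htend : ∀ t ∈ Set.Icc (-1 : ℝ) 1,
      Tendsto (fun q => cocycleProd (b t) 0 n ^ q) atTop (𝓝 0) := by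
    intro t ht
    rcases ht.1.eq_or_lt with h1 | h1
    · subst h1
      have hcc : (1 - δ) ^ n * c < 1 := by nlinarith
      refine tendsto_pow_smul_one (R := E2 →L[ℝ] E2) (mul_pos hsn0 hc0).le hcc ?_
      rw [hbp, hc, smul_smul]
      norm_num
    · obtain ⟨μ₁, μ₂, h2, h12, hlt, h3, h4⟩ := hspec t ⟨h1, ht.2⟩
      exact tendsto_pow_of_trace_det h12.ne' (by rw [abs_of_pos (h2.trans h12)]; exact hlt)
        (by rw [abs_of_pos h2]; exact h12.trans hlt) h3 h4
  obtain ⟨T, δ₀, hδ₀, hT⟩ := exists_uniform_contraction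
    (Γ := b '' Set.Icc (-1 : ℝ) 1) (isCompact_Icc.image hbc) (by
      rintro _ ⟨t, ht, rfl⟩ i
      exact tendsto_cocycleProd _ (htend t ht) i)
  have hUo : IsOpen {C : ZMod n → E2 →L[ℝ] E2 |
      HasPositiveSimpleSpectrum (toM2 (cocycleProd C 0 n))} :=
    isOpen_hasPositiveSimpleSpectrum.preimage (continuous_toM2.comp (continuous_cocycleProd 0 n))
  obtain ⟨δ₁, hδ₁, hthick⟩ := (isCompact_Icc (a := (0 : ℝ)) (b := 1)).image hbc
    |>.exists_thickening_subset_open hUo (by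
      rintro _ ⟨t, ht, rfl⟩
      obtain ⟨μ₁, μ₂, h2, h12, -, h3, h4⟩ := hspec t ⟨by linarith [ht.1], ht.2⟩
      exact hasPositiveSimpleSpectrum_of_roots h2 h12 h3 h4)
  obtain ⟨P, hP, hPb, hPm, hP0, hP1⟩ := exists_contDiff_approx_eq hbc
    (lt_min (half_pos hδ₀) (lt_min hδ₁ he))
  have hPi : ∀ t i, ‖P t i - b t i‖ ≤ min (δ₀ / 2) (min δ₁ e) := fun t i =>
    (norm_le_pi_norm (P t - b t) i).trans (hPb t).le
  refine ⟨P, hP, fun t i => ?_, ?_, ?_, ?_, fun t ht => ?_, T, δ₀ / 2, half_pos hδ₀,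
    fun t ht => ?_⟩
  · exact (hPi t i).trans ((min_le_right _ _).trans (min_le_right _ _))
  · rw [hPm, hb]; norm_num
  · rw [hP0, hb]; norm_num
  · rw [hP1, hb]; norm_num
  · refine hthick (Metric.mem_thickening_iff.2 ⟨b t, Set.mem_image_of_mem _ ht, ?_⟩)
    rw [dist_eq_norm]
    exact (hPb t).trans_le ((min_le_right _ _).trans (min_le_left _ _))
  · obtain ⟨N, hN1, hNT, hN⟩ := hT _ (Set.mem_image_of_mem _ ht)
    refine ⟨N, hN1, hNT, fun i X hX => hN i X fun j hj => ?_⟩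
    calc ‖X j - b t (i + j)‖ ≤ ‖X j - P t (i + j)‖ + ‖P t (i + j) - b t (i + j)‖ :=
          norm_sub_le_norm_sub_add_norm_sub _ _ _
      _ < δ₀ / 2 + δ₀ / 2 := add_lt_add_of_lt_of_le (hX j hj)
          ((hPi t _).trans (min_le_left _ _))
      _ = δ₀ := add_halves _

end DampedPaths

section Interpolation

variable {F : Type*} [NormedAddCommGroup F] [NormedSpace ℝ F]

/-- The scalar factor, equal to `1` for `σ ≥ S` and to `1 + w` for `σ ≤ 0`. -/
noncomputable def boost (S w σ : ℝ) : ℝ := 1 + w * (1 - Real.smoothTransition (σ / S))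

theorem contDiff_boost (S w : ℝ) : ContDiff ℝ 1 (boost S w) :=
  contDiff_const.add (contDiff_const.mul (contDiff_const.sub
    (Real.smoothTransition.contDiff.comp (contDiff_id.div_const S))))

theorem boost_zero_right (S w : ℝ) : boost S w 0 = 1 + w := by
  simp [boost, Real.smoothTransition.zero_of_nonpos]

theorem boost_eq_one {S w σ : ℝ} (hS : 0 < S) (h : S ≤ σ) : boost S w σ = 1 := by
  rw [boost, Real.smoothTransition.one_of_one_le ((one_le_div hS).2 h)]
  ring

theorem boost_zero_left (S σ : ℝ) : boost S 0 σ = 1 := by simp [boost]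

theorem boost_mem_Icc {w : ℝ} (hw : 0 ≤ w) (S σ : ℝ) : boost S w σ ∈ Set.Icc 1 (1 + w) := by
  have h0 := Real.smoothTransition.nonneg (σ / S)
  have h1 := Real.smoothTransition.le_one (σ / S)
  constructor <;> simp only [boost] <;> nlinarith

theorem boost_lt {S w σ : ℝ} (hS : 0 < S) (hw : 0 < w) (hσ : 0 < σ) : boost S w σ < 1 + w := by
  have h0 := Real.smoothTransition.pos_of_pos (div_pos hσ hS)
  simp only [boost]
  nlinarith

theorem abs_mul_deriv_boost_le {S w L : ℝ} (hS : 0 < S) (hw : 0 ≤ w)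
    (hL : ∀ x, |x| * |deriv Real.smoothTransition x| ≤ L) (σ : ℝ) :
    |σ| * |deriv (boost S w) σ| ≤ w * L := by
  have h2 := ((((Real.smoothTransition.contDiff (n := 1)).differentiable one_ne_zero
    (σ / S)).hasDerivAt.comp σ ((hasDerivAt_id σ).div_const S)).const_sub 1).const_mul w
      |>.const_add 1
  have h3 : deriv (boost S w) σ = w * -(deriv Real.smoothTransition (σ / S) * (1 / S)) := h2.deriv
  rw [h3, abs_mul, abs_neg, abs_mul, abs_of_nonneg hw, abs_of_pos (one_div_pos.2 hS)]
  calc |σ| * (w * (|deriv Real.smoothTransition (σ / S)| * (1 / S)))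
      = w * (|σ / S| * |deriv Real.smoothTransition (σ / S)|) := by
        rw [abs_div, abs_of_pos hS]; field_simp
    _ ≤ w * L := by gcongr; exact hL _

/-- The path `P`, followed along the profile at amplitude `a` and multiplied near the origin
by the factor `boost`. -/
noncomputable def interp (P : ℝ → F) (η S a w σ : ℝ) : F := boost S w σ • P (a * profile η σ)

theorem contDiff_interp {P : ℝ → F} (hP : ContDiff ℝ 1 P) {η : ℝ} (hη : 0 < η) (S a w : ℝ) :
    ContDiff ℝ 1 (interp P η S a w) :=
  (contDiff_boost S w).smul (hP.comp (contDiff_const.mul (contDiff_profile hη)))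

theorem mul_profile_mem {η a : ℝ} (hη : 0 < η) (ha : a ∈ Set.Icc (0 : ℝ) 1) (σ : ℝ) :
    a * profile η σ ∈ Set.Icc (-1 : ℝ) 1 := by
  obtain ⟨h1, h2⟩ := profile_mem_Icc hη σ
  constructor <;> nlinarith [ha.1, ha.2]

theorem rate_interp_le {P : ℝ → F} (hP : ContDiff ℝ 1 P) {η S a w L H Q : ℝ} (hη : 0 < η)
    (hS : 0 < S) (ha : a ∈ Set.Icc (0 : ℝ) 1) (hw : w ∈ Set.Icc (0 : ℝ) 1)
    (hL : ∀ x, |deriv Real.smoothTransition x| ≤ L)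
    (hL' : ∀ x, |x| * |deriv Real.smoothTransition x| ≤ L)
    (hH : ∀ t ∈ Set.Icc (-1 : ℝ) 1, ‖P t‖ ≤ H) (hQ : ∀ t ∈ Set.Icc (-1 : ℝ) 1, ‖deriv P t‖ ≤ Q)
    (σ : ℝ) : 2 * (|σ| * ‖deriv (interp P η S a w) σ‖) ≤ 2 * (w * L * H) + 12 * (Q * η * L) := by
  have hp := ((contDiff_profile hη).differentiable one_ne_zero σ).hasDerivAt.const_mul a
  have h1 := (hP.differentiable one_ne_zero (a * profile η σ)).hasDerivAt.scomp σ hp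
  have h2 := ((contDiff_boost S w).differentiable one_ne_zero σ).hasDerivAt.smul h1
  have h3 : deriv (interp P η S a w) σ = _ := h2.deriv
  have hm := mul_profile_mem hη ha σ
  have hL0 : 0 ≤ L := (abs_nonneg _).trans (hL 0)
  have hQ0 : 0 ≤ Q := (norm_nonneg _).trans (hQ _ hm)
  have hb := boost_mem_Icc hw.1 S σ
  have hb1 : |boost S w σ| ≤ 2 := by rw [abs_le]; constructor <;> linarith [hb.1, hb.2, hw.2]
  have hr := rate_profile_le hη hL σ
  have hbd := abs_mul_deriv_boost_le hS hw.1 hL' σ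
  have ha1 : |a| ≤ 1 := abs_le.2 ⟨by linarith [ha.1], ha.2⟩
  have h4 : ‖deriv (interp P η S a w) σ‖ ≤
      2 * (1 * ‖deriv (profile η) σ‖ * Q) + |deriv (boost S w) σ| * H := by
    rw [h3]
    refine (norm_add_le _ _).trans (add_le_add ?_ ?_)
    · rw [norm_smul, norm_smul, norm_mul, Real.norm_eq_abs, Real.norm_eq_abs]
      gcongr
      exact hQ _ hm
    · rw [norm_smul, Real.norm_eq_abs]
      gcongr
      exact hH _ hm
  have hH0 : 0 ≤ H := (norm_nonneg _).trans (hH _ hm)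
  calc 2 * (|σ| * ‖deriv (interp P η S a w) σ‖)
      ≤ 2 * (|σ| * (2 * (1 * ‖deriv (profile η) σ‖ * Q) + |deriv (boost S w) σ| * H)) := by gcongr
    _ = 2 * Q * (2 * (|σ| * ‖deriv (profile η) σ‖)) + 2 * ((|σ| * |deriv (boost S w) σ|) * H) := by
        ring
    _ ≤ 2 * Q * (6 * (η * L)) + 2 * (w * L * H) := by gcongr
    _ = 2 * (w * L * H) + 12 * (Q * η * L) := by ring

theorem norm_interp_le {P : ℝ → F} {η S a w H : ℝ} (hη : 0 < η)
    (ha : a ∈ Set.Icc (0 : ℝ) 1) (hw : w ∈ Set.Icc (0 : ℝ) 1)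
    (hH : ∀ t ∈ Set.Icc (-1 : ℝ) 1, ‖P t‖ ≤ H) (σ : ℝ) : ‖interp P η S a w σ‖ ≤ 2 * H := by
  have hb := boost_mem_Icc hw.1 S σ
  rw [interp, norm_smul, Real.norm_eq_abs, abs_of_pos (by linarith [hb.1])]
  gcongr
  · linarith [hb.2, hw.2]
  · exact hH _ (mul_profile_mem hη ha σ)

theorem norm_interp_sub_le {P : ℝ → F} {η S a w H : ℝ} (hη : 0 < η)
    (ha : a ∈ Set.Icc (0 : ℝ) 1) (hw : 0 ≤ w)
    (hH : ∀ t ∈ Set.Icc (-1 : ℝ) 1, ‖P t‖ ≤ H) (σ : ℝ) :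
    ‖interp P η S a w σ - P (a * profile η σ)‖ ≤ w * H := by
  have hb := boost_mem_Icc hw S σ
  have h : interp P η S a w σ - P (a * profile η σ) =
      (boost S w σ - 1) • P (a * profile η σ) := by rw [interp, sub_smul, one_smul]
  rw [h, norm_smul, Real.norm_eq_abs, abs_of_nonneg (by linarith [hb.1])]
  gcongr
  · linarith [hb.2]
  · exact hH _ (mul_profile_mem hη ha σ)

theorem interp_eq_of_le (P : ℝ → F) {η S a w σ : ℝ} (hS : 0 < S) (h : S ≤ σ) :
    interp P η S a w σ = P (a * profile η σ) := by rw [interp, boost_eq_one hS h, one_smul]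

theorem interp_zero_right (P : ℝ → F) (η S a σ : ℝ) :
    interp P η S a 0 σ = P (a * profile η σ) := by rw [interp, boost_zero_left, one_smul]

theorem interp_at_zero (P : ℝ → F) {η : ℝ} (hη : 0 < η) (S a w : ℝ) :
    interp P η S a w 0 = (1 + w) • P a := by
  rw [interp, boost_zero_right, profile_eq_one hη (Real.exp_pos _).le, mul_one]

/-- Slow variation of the interpolation in logarithmic scale, away from the zone where the scalar
factor acts. -/
theorem norm_sub_interp_lt {P : ℝ → F} (hP : ContDiff ℝ 1 P) {η a L H Q : ℝ} (hη : 0 < η)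
    (ha : a ∈ Set.Icc (0 : ℝ) 1)
    (hL : ∀ x, |deriv Real.smoothTransition x| ≤ L)
    (hL' : ∀ x, |x| * |deriv Real.smoothTransition x| ≤ L)
    (hH : ∀ t ∈ Set.Icc (-1 : ℝ) 1, ‖P t‖ ≤ H) (hQ : ∀ t ∈ Set.Icc (-1 : ℝ) 1, ‖deriv P t‖ ≤ Q)
    {l d : ℝ} (hd : 6 * (Q * η * L) * l < d) {σ σ' : ℝ} (hσ : 0 < σ) (hσ' : 0 < σ')
    (hl : |Real.log σ' - Real.log σ| ≤ l) :
    ‖P (a * profile η σ') - P (a * profile η σ)‖ < d := by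
  have h := norm_sub_le_log_of_rate (contDiff_interp hP hη 1 a 0)
    (rate_interp_le hP hη one_pos ha ⟨le_rfl, zero_le_one⟩ hL hL' hH hQ) hσ hσ'
  rw [interp_zero_right, interp_zero_right] at h
  have hL0 : 0 ≤ L := (abs_nonneg _).trans (hL 0)
  have hQ0 : 0 ≤ Q := (norm_nonneg _).trans (hQ 0 (by norm_num))
  have h0 : 0 ≤ 6 * (Q * η * L) := by positivity
  nlinarith [mul_le_mul_of_nonneg_left hl h0]

end Interpolation

section Contraction

variable {n : ℕ} {P : ℝ → ZMod n → E2 →L[ℝ] E2} {η S a w L H Q K δ₀ : ℝ} {T : ℕ}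

/-- The radial cocycle of maps built from the interpolated path. -/
noncomputable def interpCocycle (n : ℕ) (P : ℝ → ZMod n → E2 →L[ℝ] E2) (η S a w : ℝ)
    (i : ZMod n) : E2 → E2 := radialMap (interp (fun t => P t i) η S a w)

/-- A smooth path of linear cocycles that are uniformly contracting, together with a speed `η`
small with respect to the constants of the path. -/
structure SlowPath (n : ℕ) (P : ℝ → ZMod n → E2 →L[ℝ] E2) (η L H Q K δ₀ : ℝ) (T : ℕ) : Prop where
  contDiff : ∀ i, ContDiff ℝ 1 fun t => P t i
  pos : 0 < η
  deriv_le : ∀ x, |deriv Real.smoothTransition x| ≤ L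
  mul_deriv_le : ∀ x, |x| * |deriv Real.smoothTransition x| ≤ L
  norm_le : ∀ i, ∀ t ∈ Set.Icc (-1 : ℝ) 1, ‖P t i‖ ≤ H
  norm_deriv_le : ∀ i, ∀ t ∈ Set.Icc (-1 : ℝ) 1, ‖deriv (fun t => P t i) t‖ ≤ Q
  one_le : 1 ≤ K
  two_mul_le : 2 * H ≤ K
  le_norm : ∀ t ∈ Set.Icc (-1 : ℝ) 1, ∀ i v, K⁻¹ * ‖v‖ ≤ ‖P t i v‖
  contracting : ∀ t ∈ Set.Icc (-1 : ℝ) 1, ∃ N, 1 ≤ N ∧ N ≤ T ∧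
    ∀ (i : ZMod n) (X : ℕ → E2 →L[ℝ] E2),
      (∀ j < N, ‖X j - P t (i + j)‖ < δ₀) → ‖seqProd X N‖ ≤ 1 / 2
  slow : 6 * (Q * η * L) * (2 * T * Real.log K) < δ₀

theorem interpCocycle_zero (i : ZMod n) : interpCocycle n P η S a w i 0 = 0 := radialMap_zero _

theorem mul_norm_le_norm_interp (hη : 0 < η) (ha : a ∈ Set.Icc (0 : ℝ) 1) (hw : 0 ≤ w) {k : ℝ}
    (hlow : ∀ t ∈ Set.Icc (-1 : ℝ) 1, ∀ i v, k * ‖v‖ ≤ ‖P t i v‖) (σ : ℝ) (i : ZMod n) (v : E2) :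
    k * ‖v‖ ≤ ‖interp (fun t => P t i) η S a w σ v‖ := by
  have hb := (boost_mem_Icc hw S σ).1
  refine (hlow _ (mul_profile_mem hη ha σ) i v).trans ?_
  rw [interp, smul_apply, norm_smul, Real.norm_eq_abs,
    abs_of_pos (by linarith)]
  exact le_mul_of_one_le_left (norm_nonneg _) hb

theorem SlowPath.exists_norm_orbitPt_le_half (h : SlowPath n P η L H Q K δ₀ T)
    (hS : 0 < S) (ha : a ∈ Set.Icc (0 : ℝ) 1) (hw : w ∈ Set.Icc (0 : ℝ) 1)
    {S' : ℝ} (hS' : 0 < S') (hwS : w = 0 ∨ S ≤ S') (i : ZMod n) (x : E2)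
    (hx : S' * K ^ (2 * T) ≤ ‖x‖ ^ 2) :
    ∃ N, 1 ≤ N ∧ N ≤ T ∧ ‖orbitPt n (interpCocycle n P η S a w) i x N‖ ≤ 1 / 2 * ‖x‖ := by
  have hη := h.pos
  have hK0 : 0 < K := zero_lt_one.trans_le h.one_le
  refine _root_.exists_norm_orbitPt_le_half (D := fun σ i => interp (fun t => P t i) η S a w σ)
    (Γ := P '' Set.Icc (-1 : ℝ) 1) h.one_le (fun σ i v => ?_) (fun σ i v => ?_)
    (by rintro _ ⟨t, ht, rfl⟩; exact h.contracting t ht) hS' (fun σ hσ => ?_) i x hx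
  · refine (ContinuousLinearMap.le_opNorm _ _).trans ?_
    gcongr
    exact (norm_interp_le hη ha hw (h.norm_le i) σ).trans h.two_mul_le
  · rw [← inv_mul_le_iff₀ hK0]
    exact mul_norm_le_norm_interp hη ha hw.1 h.le_norm σ i v
  · refine ⟨_, Set.mem_image_of_mem _ (mul_profile_mem hη ha σ), fun σ' hσ' hl i => ?_⟩
    have he : interp (fun t => P t i) η S a w σ' = P (a * profile η σ') i := by
      rcases hwS with h1 | h1
      · rw [h1, interp_zero_right]
      · rw [interp_eq_of_le _ hS (h1.trans hσ')]
    beta_reduce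
    rw [he]
    exact norm_sub_interp_lt (h.contDiff i) hη ha h.deriv_le h.mul_deriv_le (h.norm_le i)
      (h.norm_deriv_le i) h.slow (hS'.trans_le hσ)
      (hS'.trans_le hσ') hl

theorem SlowPath.isContractingCocycle_interpCocycle_zero (h : SlowPath n P η L H Q K δ₀ T)
    (hS : 0 < S) (ha : a ∈ Set.Icc (0 : ℝ) 1) :
    IsContractingCocycle n (interpCocycle n P η S a 0) := by
  have hη := h.pos
  have hK0 : 0 < K := zero_lt_one.trans_le h.one_le
  have hw : (0 : ℝ) ∈ Set.Icc (0 : ℝ) 1 := ⟨le_rfl, zero_le_one⟩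
  refine isContractingCocycle_of_uniform h.one_le (fun i x => ?_) (T := T) (fun i x => ?_)
  · refine (ContinuousLinearMap.le_opNorm _ _).trans ?_
    gcongr
    exact (norm_interp_le hη ha hw (h.norm_le i) _).trans h.two_mul_le
  · rcases eq_or_ne x 0 with rfl | hx
    · obtain ⟨N, hN, hNT, -⟩ := h.contracting 0 (by norm_num)
      refine ⟨1, le_rfl, hN.trans hNT, ?_⟩
      have := orbitPt_succ (interpCocycle n P η S a 0) i 0 0
      rw [orbitPt_zero, interpCocycle_zero] at this
      simp [this]
    · have hx' := norm_pos_iff.2 hx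
      have hKp : 0 < K ^ (2 * T) := by positivity
      exact h.exists_norm_orbitPt_le_half hS ha hw
        (S' := ‖x‖ ^ 2 / K ^ (2 * T)) (by positivity) (Or.inl rfl) i x
        (div_mul_cancel₀ _ hKp.ne').le

theorem SlowPath.isContractingCocycle_interpCocycle_one (h : SlowPath n P η L H Q K δ₀ T)
    (hS : 0 < S) (hw : w ∈ Set.Icc (0 : ℝ) 1)
    {C : ZMod n → E2 →L[ℝ] E2} {δ κ M : ℝ} (hδ : 0 < δ) (hδ1 : δ < 1)
    (hκ : (1 - δ) * (1 + κ) = 1) (hwκ : w ≤ κ) (hC : P 1 = (1 - δ) • C)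
    (hM : ∀ i N, ‖cocycleProd C i N‖ ≤ M)
    (hSM : M ^ 2 * (S * K ^ (2 * T)) ≤ Real.exp (-3 / η)) :
    IsContractingCocycle n (interpCocycle n P η S 1 w) := by
  have hη := h.pos
  have hK0 : 0 < K := zero_lt_one.trans_le h.one_le
  have h1 : (1 : ℝ) ∈ Set.Icc (0 : ℝ) 1 := ⟨zero_le_one, le_rfl⟩
  have hKp : 0 < K ^ (2 * T) := by positivity
  have hκ0 : 0 < κ := by nlinarith
  refine isContractingCocycle_of_eventually fun i x => ?_
  obtain ⟨m, hm⟩ := exists_norm_orbitPt_lt (n := n) (f := interpCocycle n P η S 1 w)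
    (s := √(S * K ^ (2 * T))) (by positivity) (fun i x hx => by
      obtain ⟨N, -, -, hN⟩ := h.exists_norm_orbitPt_le_half hS h1 hw hS (Or.inr le_rfl) i x
        (by rwa [Real.sqrt_le_left (norm_nonneg _)] at hx)
      exact ⟨N, hN⟩) i x
  refine ⟨m, tendsto_orbitPt_of_scalar (φ := fun σ => (1 - δ) * boost S w σ)
    (S := Real.exp (-3 / η)) hM (continuous_const.mul (contDiff_boost S w).continuous)
    (fun σ => ?_) (fun σ => ?_) (fun σ hσ => ?_) (fun i x hx => ?_) _ _ ?_⟩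
  · have := (boost_mem_Icc hw.1 S σ).1
    exact mul_pos (by linarith) (by linarith)
  · have := (boost_mem_Icc hw.1 S σ).2
    nlinarith
  · have hlt : boost S w σ < 1 + κ := by
      rcases hw.1.eq_or_lt with h2 | h2
      · rw [← h2, boost_zero_left]; linarith
      · linarith [boost_lt hS h2 hσ]
    nlinarith
  · rw [interpCocycle, radialMap, interp, profile_eq_one hη hx, mul_one]
    beta_reduce
    rw [hC, Pi.smul_apply, smul_smul, mul_comm, smul_apply]
  · refine le_trans ?_ hSM
    gcongr
    exact ((Real.lt_sqrt (norm_nonneg _)).1 hm).le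

end Contraction

section Derivatives

theorem hasFDerivAt_compUpTo {n : ℕ} {f : ZMod n → E2 → E2} {D : ZMod n → E2 →L[ℝ] E2}
    (h0 : ∀ i, f i 0 = 0) (hD : ∀ i, HasFDerivAt (f i) (D i) 0) (j : ℕ) :
    compUpTo n f 0 j 0 = 0 ∧ HasFDerivAt (compUpTo n f 0 j) (cocycleProd D 0 j) 0 := by
  induction j with
  | zero => exact ⟨rfl, hasFDerivAt_id 0⟩
  | succ j ih =>
    refine ⟨by rw [compUpTo, Function.comp_apply, ih.1, h0], ?_⟩
    have h := hD (0 + (j : ZMod n))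
    rw [← ih.1] at h
    exact h.comp 0 ih.2

theorem fderiv_compUpTo_interpCocycle {n : ℕ} {P : ℝ → ZMod n → E2 →L[ℝ] E2}
    (hP : ∀ i, ContDiff ℝ 1 fun t => P t i) {η : ℝ} (hη : 0 < η) (S a w : ℝ) :
    fderiv ℝ (compUpTo n (interpCocycle n P η S a w) 0 n) 0 =
      (1 + w) ^ n • cocycleProd (P a) 0 n := by
  have h : ∀ i, HasFDerivAt (interpCocycle n P η S a w i) (((1 + w) • P a) i) 0 := fun i => by
    have := fderiv_radialMap_zero (contDiff_interp (hP i) hη S a w)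
    rwa [interp_at_zero _ hη] at this
  rw [(hasFDerivAt_compUpTo (fun i => interpCocycle_zero i) h n).2.fderiv, cocycleProd_smul]

/-- Derivatives of the retards of a cocycle are values of derivatives of the cocycle. -/
theorem norm_fderiv_retard_sub_le {n : ℕ} {f : ZMod n → E2 → E2} {B : ZMod n → M2}
    {lam r R : ℝ} (hret : IsRetardable n f B lam r R) (hfd : ∀ i, Differentiable ℝ (f i))
    {ρ' ρ : ℝ} (h1 : r < ρ') (h2 : ρ' < ρ) (h3 : ρ < R) (m : ℕ) {A : ZMod n → E2 →L[ℝ] E2} {c : ℝ}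
    (hf : ∀ i x, ‖fderiv ℝ (f i) x - A i‖ ≤ c) (i : ZMod n) (x : E2) :
    ‖fderiv ℝ (retard n f B lam ρ' ρ m i) x - A i‖ ≤ c := by
  obtain ⟨-, hl0, hl1, hr, -, -, hB⟩ := hret
  set l := lam ^ m with hl
  have hlpos : 0 < l := pow_pos hl0 m
  have hlle : l ≤ 1 := pow_le_one₀ hl0.le hl1.le
  have hlρ : l * ρ' ≤ ρ' := mul_le_of_le_one_left (by linarith) hlle
  have hBf : ∀ y : E2, r < ‖y‖ → ‖y‖ < R → f i =ᶠ[𝓝 y] mCLM (B i) := fun y hy hy' => by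
    filter_upwards [(isOpen_lt continuous_const continuous_norm).mem_nhds hy,
      (isOpen_lt continuous_norm continuous_const).mem_nhds hy'] with z hz hz'
    exact hB i z (le_of_lt hz) (le_of_lt hz')
  by_cases hx1 : ρ' < ‖x‖
  · have he : retard n f B lam ρ' ρ m i =ᶠ[𝓝 x] f i := by
      filter_upwards [(isOpen_lt continuous_const continuous_norm).mem_nhds hx1] with y hy
      have hy : ρ' < ‖y‖ := hy
      rw [retard]
      split_ifs with h4 h5
      · rfl
      · exact (hB i y (by linarith) (by linarith)).symm
      · exact absurd (hlρ.trans hy.le) h5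
    rw [he.fderiv_eq]
    exact hf i x
  rw [not_lt] at hx1
  by_cases hx2 : l * ρ' ≤ ‖x‖
  · have he : retard n f B lam ρ' ρ m i =ᶠ[𝓝 x] mCLM (B i) := by
      have hlx : l * r < ‖x‖ := (mul_lt_mul_of_pos_left h1 hlpos).trans_le hx2
      filter_upwards [(isOpen_lt continuous_const continuous_norm).mem_nhds hlx,
        (isOpen_lt continuous_norm continuous_const).mem_nhds (hx1.trans_lt h2)] with y hy hy'
      have hy : l * r < ‖y‖ := hy
      have hy' : ‖y‖ < ρ := hy'
      rw [retard]
      split_ifs with h4 h5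
      · exact absurd hy' h4.not_gt
      · rfl
      · rw [← hl] at h5 ⊢
        rw [not_le] at h5
        have hn : ‖l⁻¹ • y‖ = l⁻¹ * ‖y‖ := by
          rw [norm_smul, Real.norm_eq_abs, abs_of_pos (inv_pos.2 hlpos)]
        have hn1 : r < l⁻¹ * ‖y‖ := (lt_inv_mul_iff₀ hlpos).2 hy
        have hn2 : l⁻¹ * ‖y‖ < ρ' := (inv_mul_lt_iff₀ hlpos).2 h5
        rw [hB i _ (hn ▸ hn1.le) (hn ▸ (by linarith)), mact, map_smul, smul_smul,
          mul_inv_cancel₀ hlpos.ne', one_smul]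
    obtain ⟨y, hy⟩ := exists_norm_eq E2 (c := ρ) (by linarith)
    have hfy := hf i y
    rw [(hBf y (by linarith) (by linarith)).fderiv_eq, ContinuousLinearMap.fderiv] at hfy
    rwa [he.fderiv_eq, ContinuousLinearMap.fderiv]
  · rw [not_le] at hx2
    have he : retard n f B lam ρ' ρ m i =ᶠ[𝓝 x] fun y => l • f i (l⁻¹ • y) := by
      filter_upwards [(isOpen_lt continuous_norm continuous_const).mem_nhds hx2] with y hy
      have hy : ‖y‖ < l * ρ' := hy
      rw [retard, if_neg (by linarith), if_neg (by rw [← hl]; linarith)]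
    have hd : HasFDerivAt (fun y => l • f i (l⁻¹ • y)) (fderiv ℝ (f i) (l⁻¹ • x)) x := by
      have h4 := ((hfd i (l⁻¹ • x)).hasFDerivAt.comp x
        ((hasFDerivAt_id x).const_smul l⁻¹)).const_smul l
      refine h4.congr_fderiv ?_
      ext v
      simp [hlpos.ne']
    rw [he.fderiv_eq, hd.fderiv]
    exact hf i _

end Derivatives

section Assembly

theorem exists_damping {τ L H : ℝ} (hτ : 0 < τ) (hL : 0 < L) (hH : 0 < H) :
    ∃ δ κ : ℝ, 0 < δ ∧ δ ≤ 1 / 2 ∧ (1 - δ) * (1 + κ) = 1 ∧ 0 ≤ κ ∧ κ ≤ 1 ∧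
      16 * (δ * H) ≤ τ ∧ 16 * (κ * H) ≤ τ ∧ 16 * (2 * (κ * L * H)) ≤ τ := by
  obtain ⟨δ, hδ, h⟩ : ∃ δ, 0 < δ ∧ δ ≤ min (1 / 2) (τ / (64 * ((L + 1) * H))) :=
    ⟨_, by positivity, le_rfl⟩
  have h1 := (le_min_iff.1 h).1
  have h2 := (le_min_iff.1 h).2
  rw [le_div_iff₀ (by positivity)] at h2
  have hδ1 : 0 < 1 - δ := by linarith
  have hκ : δ / (1 - δ) ≤ 2 * δ := by
    rw [div_le_iff₀ hδ1]
    nlinarith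
  have hκ0 : 0 ≤ δ / (1 - δ) := by positivity
  have hδH : 0 < δ * H := by positivity
  have hδLH : 0 < δ * L * H := by positivity
  refine ⟨δ, δ / (1 - δ), hδ, h1, by field_simp; ring, hκ0, by linarith, by nlinarith, ?_, ?_⟩
  · nlinarith [mul_le_mul_of_nonneg_right hκ hH.le]
  · nlinarith [mul_le_mul_of_nonneg_right hκ (mul_pos hL hH).le]

theorem exists_speed {X Y t d l : ℝ} (ht : 0 < t) (hd : 0 < d) (hl : 0 < l) :
    ∃ η : ℝ, 0 < η ∧ X * η < t ∧ Y * η < d ∧ Real.exp (-1 / η / 2) < l := by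
  have h1 : ∀ Z z : ℝ, 0 < z → ∀ᶠ η in 𝓝[>] (0 : ℝ), Z * η < z := fun Z z hz => by
    have h : Tendsto (fun η : ℝ => Z * η) (𝓝[>] 0) (𝓝 (Z * 0)) :=
      (continuous_const.mul continuous_id).continuousAt.tendsto.mono_left nhdsWithin_le_nhds
    exact h.eventually_lt_const (by rwa [mul_zero])
  have h2 : Tendsto (fun η : ℝ => Real.exp (-1 / η / 2)) (𝓝[>] 0) (𝓝 0) := by
    refine Real.tendsto_exp_atBot.comp ?_
    have h := (tendsto_inv_nhdsGT_zero (𝕜 := ℝ)).const_mul_atTop_of_neg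
      (show (-1 / 2 : ℝ) < 0 by norm_num)
    refine h.congr fun η => ?_
    ring
  obtain ⟨η, h3, h4, h5, h6⟩ := ((eventually_mem_nhdsWithin (a := (0 : ℝ)) (s := Set.Ioi 0)).and
    ((h1 X t ht).and ((h1 Y d hd).and (h2.eventually_lt_const hl)))).exists
  exact ⟨η, h3, h4, h5, h6⟩

theorem exists_bound_cocycleProd_of_trace_det {n : ℕ} [NeZero n] {C : ZMod n → E2 →L[ℝ] E2} {μ : ℝ}
    (hμ0 : 0 < μ) (hμ1 : μ < 1) (htr : (toM2 (cocycleProd C 0 n)).trace = 1 + μ)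
    (hdet : (toM2 (cocycleProd C 0 n)).det = 1 * μ) :
    ∃ M, 1 ≤ M ∧ ∀ i N, ‖cocycleProd C i N‖ ≤ M := by
  have h := mCLM_mul_self htr hdet
  rw [mCLM_toM2] at h
  obtain ⟨b, hb⟩ := exists_bound_pow_of_quadratic hμ1.ne' (by norm_num)
    (by rw [abs_of_pos hμ0]; exact hμ1.le) h
  exact exists_bound_cocycleProd C hb

variable {n : ℕ} {P : ℝ → ZMod n → E2 →L[ℝ] E2} {η S a w L H Q K δ₀ : ℝ} {T : ℕ}

theorem SlowPath.contDiff_interpCocycle (h : SlowPath n P η L H Q K δ₀ T) (S a w : ℝ) (i : ZMod n) :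
    ContDiff ℝ 1 (interpCocycle n P η S a w i) :=
  contDiff_radialMap (contDiff_interp (h.contDiff i) h.pos S a w)

theorem SlowPath.isDiffeoCocycle (h : SlowPath n P η L H Q K δ₀ T) (hS : 0 < S)
    (ha : a ∈ Set.Icc (0 : ℝ) 1) (hw : w ∈ Set.Icc (0 : ℝ) 1) {k : ℝ}
    (hk : ∀ t ∈ Set.Icc (-1 : ℝ) 1, ∀ i v, k * ‖v‖ ≤ ‖P t i v‖)
    (hr : 2 * (w * L * H) + 12 * (Q * η * L) < k) :
    IsDiffeoCocycle n (interpCocycle n P η S a w) := by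
  intro i
  obtain ⟨hb, hinv⟩ := contDiff_invFun_radialMap (contDiff_interp (h.contDiff i) h.pos S a w)
    (rate_interp_le (h.contDiff i) h.pos hS ha hw h.deriv_le h.mul_deriv_le (h.norm_le i)
      (h.norm_deriv_le i)) hr (fun σ v => mul_norm_le_norm_interp h.pos ha hw.1 hk σ i v)
  exact ⟨⟨h.contDiff_interpCocycle S a w i, hb, hinv⟩, interpCocycle_zero i⟩

theorem SlowPath.norm_fderiv_sub_le (h : SlowPath n P η L H Q K δ₀ T) (hS : 0 < S)
    (ha : a ∈ Set.Icc (0 : ℝ) 1) (hw : w ∈ Set.Icc (0 : ℝ) 1) {C : ZMod n → E2 →L[ℝ] E2} {e : ℝ}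
    (he : ∀ t ∈ Set.Icc (-1 : ℝ) 1, ∀ i, ‖P t i - C i‖ ≤ e) (i : ZMod n) (x : E2) :
    ‖fderiv ℝ (interpCocycle n P η S a w i) x - C i‖ ≤
      2 * (w * L * H) + 12 * (Q * η * L) + w * H + e := by
  have h1 := norm_fderiv_radialMap_sub_le (contDiff_interp (h.contDiff i) h.pos S a w)
    (rate_interp_le (h.contDiff i) h.pos hS ha hw h.deriv_le h.mul_deriv_le (h.norm_le i)
      (h.norm_deriv_le i)) x
  have h2 := norm_interp_sub_le (S := S) h.pos ha hw.1 (h.norm_le i) (‖x‖ ^ 2)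
  have h3 := he _ (mul_profile_mem h.pos ha (‖x‖ ^ 2)) i
  refine (norm_sub_le_norm_sub_add_norm_sub _ _ _).trans (add_le_add
    ((norm_sub_le_norm_sub_add_norm_sub _ _ _).trans (add_le_add h1 h2)) h3)

theorem interpCocycle_apply_of_le (hS : 0 < S) (i : ZMod n) {x : E2} (hx : S ≤ ‖x‖ ^ 2) :
    interpCocycle n P η S a w i x = P (a * profile η (‖x‖ ^ 2)) i x := by
  rw [interpCocycle, radialMap, interp_eq_of_le _ hS hx]

theorem continuous_interpCocycle (hP : ∀ i, ContDiff ℝ 1 fun t => P t i) (hη : 0 < η) (S : ℝ)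
    {α ω : ℝ → ℝ} (hα : Continuous α) (hω : Continuous ω) (i : ZMod n) :
    Continuous fun p : ℝ × E2 => interpCocycle n P η S (α p.1) (ω p.1) i p.2 := by
  have h1 : Continuous fun p : ℝ × E2 => ‖p.2‖ ^ 2 := by fun_prop
  have h2 : Continuous fun p : ℝ × E2 => α p.1 * profile η (‖p.2‖ ^ 2) :=
    (hα.comp continuous_fst).mul ((contDiff_profile hη).continuous.comp h1)
  have h3 : Continuous fun p : ℝ × E2 => boost S (ω p.1) (‖p.2‖ ^ 2) :=
    continuous_const.add ((hω.comp continuous_fst).mul (continuous_const.sub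
      (Real.smoothTransition.continuous.comp (h1.div_const S))))
  exact (h3.smul ((hP i).continuous.comp h2)).clm_apply continuous_snd

theorem isRetardable_interpCocycle (hη : 0 < η) (hS : 0 < S) (hSη : S ≤ Real.exp (-2 / η))
    (hu : ∀ i, IsUnit (P (-1) i)) {lam : ℝ} (hl0 : 0 < lam) (hl1 : lam < 1)
    (hl : cocycleProd (P (-1)) 0 n = lam • (1 : E2 →L[ℝ] E2))
    (hηl : Real.exp (-1 / η / 2) < lam) :
    IsRetardable n (interpCocycle n P η S 1 w) (fun i => toM2 (P (-1) i)) lam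
      (Real.exp (-1 / η)) (Real.exp (-1 / η / 2)) := by
  have hR := Real.exp_pos (-1 / η / 2)
  have hsq : ∀ y, Real.exp y = Real.exp (y / 2) ^ 2 := fun y => by
    rw [← Real.exp_nat_mul]
    congr 1
    push_cast
    ring
  refine ⟨fun i => isUnit_toM2 (hu i), hl0, hl1, Real.exp_pos _, ?_, ?_, fun i x hx hx' => ?_⟩
  · rw [hsq (-1 / η), sq]
    exact mul_lt_mul_of_pos_right hηl hR
  · rw [← toM2_mCLM (cocProd n _), mCLM_cocProd]
    simp only [mCLM_toM2]
    rw [hl, map_smul, ← mCLM_one, toM2_mCLM]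
  · have h1 : Real.exp (-2 / η) ≤ ‖x‖ ^ 2 := by
      rw [hsq (-2 / η), show -2 / η / 2 = -1 / η by ring]
      gcongr
    have h2 : ‖x‖ ^ 2 ≤ Real.exp (-1 / η) := by
      rw [hsq (-1 / η)]
      gcongr
    rw [interpCocycle_apply_of_le hS i (hSη.trans h1), profile_eq_neg_one hη h1 h2, mact, mCLM_toM2]
    norm_num

theorem HasPositiveSimpleSpectrum.exists_eigenvalues_smul {C : E2 →L[ℝ] E2}
    (h : HasPositiveSimpleSpectrum (toM2 C)) {s : ℝ} (hs : 0 < s) : ∃ μ₁ μ₂ : ℝ, 0 < μ₂ ∧ μ₂ < μ₁ ∧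
      Module.End.HasEigenvalue (ContinuousLinearMap.toLinearMap (s • C)) μ₁ ∧
      Module.End.HasEigenvalue (ContinuousLinearMap.toLinearMap (s • C)) μ₂ := by
  have h1 := (h.smul hs).exists_eigenvalues
  rwa [← map_smul, mCLM_toM2] at h1

end Assembly

theorem IsFlexible.exists_slowPath {n : ℕ} [NeZero n] {ε : ℝ} {A : ZMod n → M2} (hε : 0 < ε)
    (h : IsFlexible n ε A) :
    ∃ (P : ℝ → ZMod n → E2 →L[ℝ] E2) (η L H Q K δ₀ : ℝ) (T : ℕ), SlowPath n P η L H Q K δ₀ T ∧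
      P 0 = (fun i => mCLM (A i)) ∧
      (∀ t ∈ Set.Icc (0 : ℝ) 1, HasPositiveSimpleSpectrum (toM2 (cocycleProd (P t) 0 n))) ∧
      (∃ lam, 0 < lam ∧ lam < 1 ∧ cocycleProd (P (-1)) 0 n = lam • (1 : E2 →L[ℝ] E2) ∧
        Real.exp (-1 / η / 2) < lam) ∧
      ∃ δ κ, 0 < δ ∧ δ < 1 ∧ (1 - δ) * (1 + κ) = 1 ∧ κ ∈ Set.Icc (0 : ℝ) 1 ∧
        (∃ k > 0, (∀ t ∈ Set.Icc (-1 : ℝ) 1, ∀ i v, k * ‖v‖ ≤ ‖P t i v‖) ∧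
          2 * (κ * L * H) + 12 * (Q * η * L) < k) ∧
        (∃ e, (∀ t ∈ Set.Icc (-1 : ℝ) 1, ∀ i, ‖P t i - mCLM (A i)‖ ≤ e) ∧
          2 * (κ * L * H) + 12 * (Q * η * L) + κ * H + e < ε) ∧
        ∃ (C : ZMod n → E2 →L[ℝ] E2) (μ : ℝ), P 1 = (1 - δ) • C ∧ 0 < μ ∧ μ < 1 ∧
          (toM2 (cocycleProd C 0 n)).trace = 1 + μ ∧ (toM2 (cocycleProd C 0 n)).det = 1 * μ := by
  obtain ⟨a, hac, ha0, ⟨ε₀, hε₀, had⟩, ⟨k, hk0, hk⟩, ⟨c, hc0, hc1, hc⟩, hmid, μ, hμ0, hμ1, htr,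
    hdet⟩ := h.exists_path hε
  obtain ⟨J, hJ0, hJ⟩ := exists_forall_norm_le_of_isCompact hac
  have hJ : ∀ t ∈ Set.Icc (-1 : ℝ) 1, ∀ i, ‖a t i‖ ≤ J := fun t ht i =>
    (norm_le_pi_norm (a t) i).trans (hJ t ht)
  obtain ⟨L, hL0, hL, hL'⟩ := exists_bound_deriv_smoothTransition
  obtain ⟨τ, hτ, hτk, hτε⟩ : ∃ τ, 0 < τ ∧ τ ≤ k ∧ τ ≤ ε - ε₀ :=
    ⟨min k (ε - ε₀), lt_min hk0 (sub_pos.2 hε₀), min_le_left _ _, min_le_right _ _⟩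
  obtain ⟨δ, κ, hδ, hδ2, hδκ, hκ0, hκ1, hδH, hκH, hκL⟩ :=
    exists_damping hτ hL0 (show 0 < J + 1 by linarith)
  have hδ1 : δ < 1 := by linarith
  obtain ⟨e, he0, he1, heτ⟩ : ∃ e, 0 < e ∧ e ≤ 1 ∧ e ≤ τ / 8 :=
    ⟨min 1 (τ / 8), by positivity, min_le_left _ _, min_le_right _ _⟩
  obtain ⟨P, hP, hPa, hPm, hP0, hP1, hPs, T, δ₀, hδ₀, hT⟩ :=
    exists_damped_path hac hc0 hc1 hc hmid hμ0 hμ1 htr hdet hδ hδ1 he0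
  have hPi : ∀ i, ContDiff ℝ 1 fun t => P t i := contDiff_pi.1 hP
  obtain ⟨Q, hQ0, hQ⟩ := exists_forall_norm_le_of_isCompact (hP.continuous_deriv le_rfl)
  have hQ : ∀ i, ∀ t ∈ Set.Icc (-1 : ℝ) 1, ‖deriv (fun t => P t i) t‖ ≤ Q := fun i t ht => by
    rw [(hasDerivAt_pi.1 (hP.differentiable one_ne_zero t).hasDerivAt i).deriv]
    exact (norm_le_pi_norm _ i).trans (hQ t ht)
  have hsm : ∀ t ∈ Set.Icc (-1 : ℝ) 1, ∀ i, ‖(1 - δ * t ^ 2) • a t i - a t i‖ ≤ δ * J := by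
    intro t ht i
    obtain ⟨⟨h1, h2⟩, h3⟩ := damping_mem hδ hδ1 ht
    rw [show (1 - δ * t ^ 2) • a t i - a t i = (-(δ * t ^ 2)) • a t i by module, norm_smul,
      norm_neg, Real.norm_eq_abs, abs_of_nonneg (by positivity)]
    exact mul_le_mul (by linarith) (hJ t ht i) (norm_nonneg _) hδ.le
  have hnorm : ∀ i, ∀ t ∈ Set.Icc (-1 : ℝ) 1, ‖P t i‖ ≤ J + 1 := by
    intro i t ht
    obtain ⟨⟨h1, h2⟩, h3⟩ := damping_mem hδ hδ1 ht
    have h4 : ‖(1 - δ * t ^ 2) • a t i‖ ≤ J := by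
      rw [norm_smul, Real.norm_eq_abs, abs_of_pos h1]
      exact (mul_le_of_le_one_left (norm_nonneg _) h2).trans (hJ t ht i)
    linarith [norm_le_norm_add_norm_sub' (P t i) ((1 - δ * t ^ 2) • a t i), hPa t i]
  have hlow : ∀ t ∈ Set.Icc (-1 : ℝ) 1, ∀ i v, k / 4 * ‖v‖ ≤ ‖P t i v‖ := by
    intro t ht i v
    obtain ⟨⟨h1, h2⟩, h3⟩ := damping_mem hδ hδ1 ht
    have h4 : k / 2 * ‖v‖ ≤ ‖((1 - δ * t ^ 2) • a t i) v‖ := by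
      rw [smul_apply, norm_smul, Real.norm_eq_abs, abs_of_pos h1]
      nlinarith [hk t ht i v, norm_nonneg (a t i v)]
    have h5 : ‖(P t i - (1 - δ * t ^ 2) • a t i) v‖ ≤ k / 4 * ‖v‖ :=
      ContinuousLinearMap.le_of_opNorm_le _ ((hPa t i).trans (by linarith)) v
    rw [sub_apply] at h5
    linarith [norm_sub_norm_le (((1 - δ * t ^ 2) • a t i) v) (P t i v),
      norm_sub_rev (P t i v) (((1 - δ * t ^ 2) • a t i) v)]
  obtain ⟨K, hK1, hKJ, hKk⟩ : ∃ K, 1 ≤ K ∧ 2 * (J + 1) ≤ K ∧ (k / 4)⁻¹ ≤ K :=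
    ⟨max 1 (max (2 * (J + 1)) (k / 4)⁻¹), le_max_left _ _,
      (le_max_left _ _).trans (le_max_right _ _), (le_max_right _ _).trans (le_max_right _ _)⟩
  have hn : n ≠ 0 := NeZero.ne n
  have hd0 : 0 < (1 - δ) ^ n := pow_pos (by linarith) n
  have hd1 : (1 - δ) ^ n < 1 := pow_lt_one₀ (by linarith) (by linarith) hn
  obtain ⟨η, hη, h1, h2, h3⟩ := exists_speed (X := 12 * Q * L)
    (Y := 6 * Q * L * (2 * T * Real.log K)) (show 0 < τ / 16 by positivity) hδ₀ (mul_pos hd0 hc0)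
  refine ⟨P, η, L, J + 1, Q, K, δ₀, T, ⟨hPi, hη, hL, hL', hnorm, hQ, hK1, hKJ, fun t ht i v => ?_,
    hT, by linarith⟩, hP0.trans ha0, hPs, ⟨_, mul_pos hd0 hc0, by nlinarith, ?_, h3⟩,
    δ, κ, hδ, hδ1, hδκ, ⟨hκ0, hκ1⟩, ⟨k / 4, by positivity, hlow, by linarith⟩,
    ⟨e + δ * J + ε₀, fun t ht i => ?_, by linarith⟩, a 1, μ, hP1, hμ0, hμ1, htr, hdet⟩
  · refine le_trans ?_ (hlow t ht i v)
    gcongr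
    exact inv_le_of_inv_le₀ (by positivity) hKk
  · rw [hPm, cocycleProd_smul, hc, smul_smul]
  · have h4 := had t ht i
    rw [ha0] at h4
    linarith [norm_sub_le_norm_sub_add_norm_sub (P t i) ((1 - δ * t ^ 2) • a t i) (mCLM (A i)),
      norm_sub_le_norm_sub_add_norm_sub ((1 - δ * t ^ 2) • a t i) (a t i) (mCLM (A i)),
      hPa t i, hsm t ht i]

/-- From an `ε`-flexible contracting linear cocycle one can build a retardable
contracting diffeomorphism cocycle, equal to the linear cocycle outside the unit ball, whose
retards are all `ε`-perturbations of the linear cocycle, isotopic to it through contracting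
cocycles with two distinct real positive eigenvalues at the origin, and whose return map has
at the origin one eigenvalue in `(0,1)` and one eigenvalue equal to `1`. -/
theorem stmt2 (n : ℕ) (hn : 1 ≤ n) (ε : ℝ) (hε : 0 < ε) (A : ZMod n → M2)
    (hAunit : ∀ i, IsUnit (A i))
    (hAcontr : Filter.Tendsto (fun m : ℕ => cocProd n A ^ m) Filter.atTop (nhds (0 : M2)))
    (hflex : IsFlexible n ε A) :
    ∃ (f : ZMod n → E2 → E2) (B : ZMod n → M2) (lam r R : ℝ),
      R < 1 ∧
      IsDiffeoCocycle n f ∧ IsContractingCocycle n f ∧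
      IsRetardable n f B lam r R ∧
      -- (a) `f` coincides with `A` outside the unit ball
      (∀ (i : ZMod n) (x : E2), 1 ≤ ‖x‖ → f i x = mact (A i) x) ∧
      -- (b) every retard is an `ε`-perturbation of `A`
      (∀ (m : ℕ) (ρ' ρ : ℝ), r < ρ' → ρ' < ρ → ρ < R →
        ∃ c : ℝ, c < ε ∧ ∀ (i : ZMod n) (x : E2),
          ‖fderiv ℝ (retard n f B lam ρ' ρ m i) x - mCLM (A i)‖ ≤ c) ∧
      -- (c) isotopy from the linear cocycle `A` to `f`
      (∃ g : ℝ → ZMod n → E2 → E2,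
        (∀ i, Continuous fun p : ℝ × E2 => g p.1 i p.2) ∧
        (∀ (i : ZMod n) (x : E2), g 0 i x = mact (A i) x) ∧ g 1 = f ∧
        ∀ s ∈ Set.Icc (0 : ℝ) 1,
          IsDiffeoCocycle n (g s) ∧ IsContractingCocycle n (g s) ∧
          (∀ (i : ZMod n) (x : E2), 1 ≤ ‖x‖ → g s i x = mact (A i) x) ∧
          ∃ μ₁ μ₂ : ℝ, 0 < μ₂ ∧ μ₂ < μ₁ ∧
            Module.End.HasEigenvalue
              (ContinuousLinearMap.toLinearMap (fderiv ℝ (compUpTo n (g s) 0 n) 0)) μ₁ ∧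
            Module.End.HasEigenvalue
              (ContinuousLinearMap.toLinearMap (fderiv ℝ (compUpTo n (g s) 0 n) 0)) μ₂) ∧
      -- (d) the return map of `f` has one eigenvalue in `(0,1)` and one equal to `1`
      (∃ μ : ℝ, 0 < μ ∧ μ < 1 ∧
        Module.End.HasEigenvalue
          (ContinuousLinearMap.toLinearMap (fderiv ℝ (compUpTo n f 0 n) 0)) μ ∧
        Module.End.HasEigenvalue
          (ContinuousLinearMap.toLinearMap (fderiv ℝ (compUpTo n f 0 n) 0)) 1) := by
  have : NeZero n := ⟨by omega⟩
  obtain ⟨P, η, L, H, Q, K, δ₀, T, hP, hP0, hspec, ⟨lam, hl0, hl1, hl, hηl⟩, δ, κ, hδ, hδ1, hδκ,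
    hκ, ⟨k, hk0, hk, hkr⟩, ⟨e, he, heε⟩, C, μ, hP1, hμ0, hμ1, htr, hdet⟩ := hflex.exists_slowPath hε
  have hη := hP.pos
  have hLH : 0 ≤ L * H := mul_nonneg ((abs_nonneg _).trans (hP.deriv_le 0))
    ((norm_nonneg _).trans (hP.norm_le 0 0 (by norm_num)))
  have hK0 : 0 < K := zero_lt_one.trans_le hP.one_le
  obtain ⟨M, hM1, hM⟩ := exists_bound_cocycleProd_of_trace_det hμ0 hμ1 htr hdet
  have hMK : 1 ≤ M ^ 2 * K ^ (2 * T) :=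
    one_le_mul_of_one_le_of_one_le (one_le_pow₀ hM1) (one_le_pow₀ hP.one_le)
  obtain ⟨S, hS, hSM⟩ : ∃ S, 0 < S ∧ M ^ 2 * (S * K ^ (2 * T)) = Real.exp (-3 / η) :=
    ⟨Real.exp (-3 / η) / (M ^ 2 * K ^ (2 * T)), by positivity, by field_simp⟩
  have hS3 : S ≤ Real.exp (-3 / η) := by
    rw [← hSM, mul_left_comm]
    exact le_mul_of_one_le_right hS.le hMK
  have hS2 : S ≤ Real.exp (-2 / η) := hS3.trans (Real.exp_le_exp.2 (by gcongr; norm_num))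
  have hS1 : S ≤ 1 := hS2.trans
    (Real.exp_le_one_iff.2 (div_nonpos_of_nonpos_of_nonneg (by norm_num) hη.le))
  have hdiff : ∀ a ∈ Set.Icc (0 : ℝ) 1, ∀ w ∈ Set.Icc 0 κ,
      IsDiffeoCocycle n (interpCocycle n P η S a w) := fun a ha w hw =>
    hP.isDiffeoCocycle hS ha ⟨hw.1, hw.2.trans hκ.2⟩ hk
      (by linarith [mul_le_mul_of_nonneg_right hw.2 hLH])
  have hcontr : ∀ w ∈ Set.Icc 0 κ, IsContractingCocycle n (interpCocycle n P η S 1 w) :=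
    fun w hw => hP.isContractingCocycle_interpCocycle_one hS ⟨hw.1, hw.2.trans hκ.2⟩ hδ hδ1 hδκ
      hw.2 hP1 hM hSM.le
  have hout : ∀ a w (i : ZMod n) (x : E2), 1 ≤ ‖x‖ →
      interpCocycle n P η S a w i x = mact (A i) x := fun a w i x hx => by
    have hx : 1 ≤ ‖x‖ ^ 2 := one_le_pow₀ hx
    rw [interpCocycle_apply_of_le hS i (hS1.trans hx), profile_eq_zero hη hx, mul_zero, hP0, mact]
  have hret := isRetardable_interpCocycle (w := κ) hη hS hS2
    (fun i => isUnit_of_lower_bound hk0 (hk (-1) (by norm_num) i)) hl0 hl1 hl hηl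
  have h11 : (1 : ℝ) ∈ Set.Icc (0 : ℝ) 1 := ⟨zero_le_one, le_rfl⟩
  have hκκ : κ ∈ Set.Icc 0 κ := ⟨hκ.1, le_rfl⟩
  refine ⟨interpCocycle n P η S 1 κ, fun i => toM2 (P (-1) i), lam, _, _,
    Real.exp_lt_one_iff.2 ?_, hdiff 1 h11 κ hκκ, hcontr κ hκκ, hret, hout 1 κ,
    fun m ρ' ρ h1 h2 h3 => ⟨_, heε, ?_⟩, ?_, μ, hμ0, hμ1, ?_⟩
  · have := div_pos one_pos hη
    rw [neg_div]
    linarith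
  · exact norm_fderiv_retard_sub_le hret
      (fun i => (hP.contDiff_interpCocycle S 1 κ i).differentiable one_ne_zero) h1 h2 h3 m
      (hP.norm_fderiv_sub_le hS h11 hκ he)
  · have hα : ∀ s : ℝ, max 0 (min 1 (2 * s)) ∈ Set.Icc (0 : ℝ) 1 := fun s =>
      ⟨le_max_left _ _, max_le zero_le_one (min_le_left _ _)⟩
    have hω : ∀ s : ℝ, κ * max 0 (min 1 (2 * s - 1)) ∈ Set.Icc 0 κ := fun s =>
      ⟨mul_nonneg hκ.1 (le_max_left _ _),
        mul_le_of_le_one_right hκ.1 (max_le zero_le_one (min_le_left _ _))⟩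
    refine ⟨fun s => interpCocycle n P η S (max 0 (min 1 (2 * s)))
      (κ * max 0 (min 1 (2 * s - 1))), ?_, ?_, ?_, fun s _ =>
      ⟨hdiff _ (hα s) _ (hω s), ?_, hout _ _, ?_⟩⟩
    · have hα' : Continuous fun s : ℝ => max 0 (min 1 (2 * s)) := by fun_prop
      have hω' : Continuous fun s : ℝ => κ * max 0 (min 1 (2 * s - 1)) := by fun_prop
      exact continuous_interpCocycle hP.contDiff hη S hα' hω'
    · intro i x
      norm_num [interpCocycle, radialMap, interp_zero_right, hP0, mact]
    · norm_num
    · rcases le_total (2 * s) 1 with h | h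
      · have h0 : max 0 (min 1 (2 * s - 1)) = 0 :=
          max_eq_left ((min_le_right _ _).trans (by linarith))
        simp only [h0, mul_zero]
        exact hP.isContractingCocycle_interpCocycle_zero hS (hα s)
      · have h1 : max 0 (min 1 (2 * s)) = 1 := by rw [min_eq_left h, max_eq_right zero_le_one]
        simp only [h1]
        exact hcontr _ (hω s)
    · rw [fderiv_compUpTo_interpCocycle hP.contDiff hη]
      exact (hspec _ (hα s)).exists_eigenvalues_smul (pow_pos (by linarith [(hω s).1]) n)
  · have hmul : (1 + κ) * (1 - δ) = 1 := by linarith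
    rw [fderiv_compUpTo_interpCocycle hP.contDiff hη, hP1, cocycleProd_smul, smul_smul, ← mul_pow,
      hmul, one_pow, one_smul, ← mCLM_toM2 (cocycleProd C 0 n)]
    exact ⟨hasEigenvalue_mCLM (by rw [htr, hdet]; ring),
      hasEigenvalue_mCLM (by rw [htr, hdet]; ring)⟩
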